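/- arXiv:2603.06261 — 2 statements merged into one kernel-verified Lean document; each statement's English description precedes it below -/
import Mathlib

section
/- Let b(n) be a sequence with n^{θ_1} ≤ b(n) ≤ n^{θ_2} for some constants 1/2 < θ_1 ≤ θ_2 < 1 and all sufficiently large n, and take b_1(n) = ⋯ = b_{k−2}(n) = b(n). Then S_B^{(k−2)}(n) = (1+o(1)) · (1/(μ n)) · ( α(k−2) / ((α−1)(k−α−1)) )^2 · ( b(n)/(μ n) )^{2(α−1)} as n → ∞. -/
open MeasureTheory Filter Set

noncomputable section

/-- `f_n(h_1,…,h_k) = ∏_{1≤i<j≤k} min(h_i h_j/(μ n), 1)`. -/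
def fDef (μ : ℝ) (n k : ℕ) (x : Fin k → ℝ) : ℝ :=
  ∏ p ∈ Finset.univ.filter (fun p : Fin k × Fin k => p.1 < p.2),
    min (x p.1 * x p.2 / (μ * n)) 1

/-- `S_B^{(h)}(n) = ∫_{[1,∞)^{k-h}} f_n(b_1,…,b_h, x_{h+1},…,x_k) dF(x_{h+1})⋯dF(x_k)`. -/
def SB (ν : Measure ℝ) (μ : ℝ) (k h : ℕ) (b : Fin h → ℝ) (n : ℕ) : ℝ :=
  ∫ x in Set.univ.pi (fun _ : Fin (k - h) => Set.Ici (1 : ℝ)),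
    fDef μ n k (fun i =>
      if hlt : i.val < h then b ⟨i.val, hlt⟩
      else x ⟨i.val - h, by have := i.isLt; omega⟩)
    ∂(Measure.pi fun _ : Fin (k - h) => ν)

/-- The truncated moment `G(y) = E[W min(W/y,1)^K]`. -/
def GG (ν : Measure ℝ) (K : ℕ) (y : ℝ) : ℝ := ∫ w, w * min (w / y) 1 ^ K ∂ν

/-- Derivative of `s min(s,1)^K`. -/
def dd (K : ℕ) (s : ℝ) : ℝ := if s ≤ 1 then (K + 1) * s ^ K else 1

lemma dd_meas (K : ℕ) : Measurable (dd K) := by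
  unfold dd
  exact Measurable.ite measurableSet_Iic (by fun_prop) measurable_const

lemma dd_nonneg (K : ℕ) {s : ℝ} (hs : 0 ≤ s) : 0 ≤ dd K s := by
  unfold dd; split_ifs <;> positivity

lemma dd_bound (K : ℕ) {s : ℝ} (hs : 0 ≤ s) : dd K s ≤ K + 1 := by
  unfold dd; split_ifs with h
  · have : s ^ K ≤ 1 := pow_le_one₀ hs h
    have : (0:ℝ) ≤ K + 1 := by positivity
    nlinarith
  · have : (0:ℝ) ≤ K := by positivity
    linarith

lemma dd_ii (K : ℕ) {t : ℝ} (ht : 0 ≤ t) : IntervalIntegrable (dd K) volume 0 t := by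
  rw [intervalIntegrable_iff_integrableOn_Ioc_of_le ht]
  refine Measure.integrableOn_of_bounded (M := (K:ℝ) + 1) (by simp) (dd_meas K).aestronglyMeasurable ?_
  refine ae_restrict_of_forall_mem measurableSet_Ioc ?_
  intro s hs
  rw [Real.norm_of_nonneg (dd_nonneg K hs.1.le)]
  exact dd_bound K hs.1.le

lemma dd_int1 (K : ℕ) {t : ℝ} (ht : 0 ≤ t) (h1 : t ≤ 1) : ∫ s in (0:ℝ)..t, dd K s = t ^ (K + 1) := by
  have : ∫ s in (0:ℝ)..t, dd K s = ∫ s in (0:ℝ)..t, (K + 1 : ℝ) * s ^ K := by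
    apply intervalIntegral.integral_congr
    intro s hs
    rw [uIcc_of_le ht] at hs
    simp only [dd]
    rw [if_pos (hs.2.trans h1)]
  rw [this, intervalIntegral.integral_const_mul, integral_pow]
  have : (K:ℝ) + 1 ≠ 0 := by positivity
  field_simp
  simp

lemma dd_int (K : ℕ) {t : ℝ} (ht : 0 ≤ t) : ∫ s in (0:ℝ)..t, dd K s = t * min t 1 ^ K := by
  rcases le_total t 1 with h | h
  · rw [dd_int1 K ht h, min_eq_left h]; ring
  · have h2 : ∫ s in (1:ℝ)..t, dd K s = t - 1 := by
      have : ∫ s in (1:ℝ)..t, dd K s = ∫ s in (1:ℝ)..t, (1:ℝ) := by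
        apply intervalIntegral.integral_congr_ae
        refine ae_of_all _ ?_
        intro s hs
        rw [uIoc_of_le h] at hs
        simp only [dd]
        rw [if_neg (not_le.mpr hs.1)]
      rw [this]; simp
    have i1 := dd_ii K (zero_le_one)
    have i2 := dd_ii K ht
    rw [← intervalIntegral.integral_add_adjacent_intervals i1 (i1.symm.trans i2), h2,
      dd_int1 K zero_le_one le_rfl, min_eq_right h]
    simp

lemma GG_eq (ν : Measure ℝ) [IsProbabilityMeasure ν] (hsupp : ν (Set.Iio 1) = 0) (K : ℕ) {y : ℝ}
    (hy : 0 < y) :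
    GG ν K y = y * ∫ s in Ioi (0:ℝ), dd K s * (ν (Ioi (y * s))).toReal := by
  have hpos : ∀ᵐ w ∂ν, (0:ℝ) ≤ w := by
    rw [ae_iff]
    refine measure_mono_null ?_ hsupp
    intro x hx
    simp only [mem_ofPred_eq, not_le] at hx
    simp only [mem_Iio]; linarith
  have key := lintegral_comp_eq_lintegral_meas_lt_mul (μ := ν) (f := fun w => w / y) (g := dd K)
    (by filter_upwards [hpos] with w hw; simp only [Pi.zero_apply]; positivity)
    (by fun_prop) (fun t ht => dd_ii K ht.le)
    (ae_restrict_of_forall_mem measurableSet_Ioi (fun s hs => dd_nonneg K (le_of_lt hs)))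
  have e1 : GG ν K y = y * ∫ w, (w / y) * min (w / y) 1 ^ K ∂ν := by
    unfold GG
    rw [← integral_const_mul]
    congr 1; ext w; field_simp
  rw [e1]
  congr 1
  rw [integral_eq_lintegral_of_nonneg_ae, integral_eq_lintegral_of_nonneg_ae]
  · congr 1
    rw [← lintegral_congr_ae (μ := ν) (f := fun w => ENNReal.ofReal (∫ t in (0:ℝ)..(w / y), dd K t)), key]
    · apply setLIntegral_congr_fun measurableSet_Ioi
      intro s hs
      simp only
      rw [ENNReal.ofReal_mul (dd_nonneg K (le_of_lt hs)), ENNReal.ofReal_toReal (measure_ne_top _ _), mul_comm]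
      congr 2
      ext w
      simp only [mem_ofPred_eq, mem_Ioi]
      rw [lt_div_iff₀ hy, mul_comm]
    · filter_upwards [hpos] with w hw
      rw [dd_int K (by positivity)]
  · refine ae_restrict_of_forall_mem measurableSet_Ioi (fun s hs => ?_)
    exact mul_nonneg (dd_nonneg K (le_of_lt hs)) ENNReal.toReal_nonneg
  · apply Measurable.aestronglyMeasurable
    apply (dd_meas K).mul
    apply Measurable.ennreal_toReal
    have : Antitone (fun s : ℝ => ν (Ioi (y * s))) := by
      intro s t hst
      exact measure_mono (Ioi_subset_Ioi (by gcongr))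
    exact this.measurable
  · filter_upwards [hpos] with w hw
    simp only [Pi.zero_apply]; positivity
  · exact Measurable.aestronglyMeasurable (by fun_prop)

lemma dd_lim_int (K : ℕ) (hK : 1 ≤ K) (α : ℝ) (h1 : 1 < α) (h2 : α < 2) :
    IntegrableOn (fun s : ℝ => dd K s * s ^ (-α)) (Ioi 0) ∧
    ∫ s in Ioi (0:ℝ), dd K s * s ^ (-α) = α * K / ((α - 1) * (K + 1 - α)) := by
  have hK' : (1:ℝ) ≤ K := by exact_mod_cast hK
  have ea : EqOn (fun s : ℝ => (K + 1 : ℝ) * s ^ ((K:ℝ) - α)) (fun s : ℝ => dd K s * s ^ (-α)) (Ioc 0 1) := by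
    intro s hs
    simp only [dd]
    rw [if_pos hs.2, sub_eq_add_neg, Real.rpow_add hs.1, Real.rpow_natCast]; ring
  have eb : EqOn (fun s : ℝ => s ^ (-α)) (fun s : ℝ => dd K s * s ^ (-α)) (Ioi 1) := by
    intro s hs
    simp only [dd]
    rw [if_neg (not_le.mpr hs)]; ring
  have ia : IntegrableOn (fun s : ℝ => dd K s * s ^ (-α)) (Ioc 0 1) := by
    refine IntegrableOn.congr_fun ?_ ea measurableSet_Ioc
    have := (intervalIntegral.intervalIntegrable_rpow' (a := 0) (b := 1) (r := (K:ℝ) - α) (by linarith)).const_mul (K+1:ℝ)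
    rwa [intervalIntegrable_iff_integrableOn_Ioc_of_le zero_le_one] at this
  have ib : IntegrableOn (fun s : ℝ => dd K s * s ^ (-α)) (Ioi 1) := by
    refine IntegrableOn.congr_fun ?_ eb measurableSet_Ioi
    exact integrableOn_Ioi_rpow_of_lt (by linarith) one_pos
  have hu : Ioc (0:ℝ) 1 ∪ Ioi 1 = Ioi 0 := Ioc_union_Ioi_eq_Ioi zero_le_one
  constructor
  · rw [← hu]; exact ia.union ib
  · rw [← hu, setIntegral_union (by
        rw [Set.disjoint_left]; intro x hx hx'; exact absurd hx.2 (not_le.mpr hx')) measurableSet_Ioi ia ib,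
      ← setIntegral_congr_fun measurableSet_Ioc ea, ← setIntegral_congr_fun measurableSet_Ioi eb,
      integral_Ioi_rpow_of_lt (by linarith) one_pos, ← intervalIntegral.integral_of_le zero_le_one,
      intervalIntegral.integral_const_mul, integral_rpow (Or.inl (by linarith))]
    rw [Real.one_rpow, Real.one_rpow, Real.zero_rpow (by linarith)]
    have a1 : α - 1 ≠ 0 := by linarith
    have a2 : (K:ℝ) + 1 - α ≠ 0 := by linarith
    have a3 : (K:ℝ) - α + 1 ≠ 0 := by linarith
    have a4 : -α + 1 ≠ 0 := by linarith
    rw [show (K:ℝ) - α + 1 = K + 1 - α by ring, show -α + 1 = -(α - 1) by ring]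
    field_simp
    ring

lemma tail_bound (α : ℝ) (h1 : 1 < α) (ν : Measure ℝ) [IsProbabilityMeasure ν]
    (htail : Tendsto (fun x : ℝ => x ^ α * (ν (Set.Ioi x)).toReal) atTop (nhds 1)) :
    ∃ C : ℝ, ∀ x > 0, x ^ α * (ν (Set.Ioi x)).toReal ≤ C := by
  have := htail.eventually (eventually_le_nhds (show (1:ℝ) < 2 by norm_num))
  obtain ⟨A, hA⟩ := eventually_atTop.mp this
  refine ⟨max 2 (|A| ^ α), fun x hx => ?_⟩
  rcases le_total A x with h | h
  · exact (hA x h).trans (le_max_left _ _)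
  · refine le_trans ?_ (le_max_right _ _)
    have hp : (ν (Set.Ioi x)).toReal ≤ 1 := by
      have := prob_le_one (μ := ν) (s := Ioi x)
      exact ENNReal.toReal_le_of_le_ofReal zero_le_one (by simpa using this)
    calc x ^ α * (ν (Set.Ioi x)).toReal ≤ x ^ α * 1 := by gcongr
      _ = x ^ α := mul_one _
      _ ≤ |A| ^ α := by
        apply Real.rpow_le_rpow hx.le (h.trans (le_abs_self A)) (by linarith)

lemma GG_tendsto (α : ℝ) (h1 : 1 < α) (h2 : α < 2) (ν : Measure ℝ) [IsProbabilityMeasure ν]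
    (hsupp : ν (Set.Iio 1) = 0)
    (htail : Tendsto (fun x : ℝ => x ^ α * (ν (Set.Ioi x)).toReal) atTop (nhds 1))
    (K : ℕ) (hK : 1 ≤ K) :
    Tendsto (fun y : ℝ => y ^ (α - 1) * GG ν K y) atTop (nhds (α * K / ((α - 1) * (K + 1 - α)))) := by
  obtain ⟨hi, he⟩ := dd_lim_int K hK α h1 h2
  obtain ⟨C, hC⟩ := tail_bound α h1 ν htail
  rw [← he]
  have hT : Tendsto (fun y : ℝ => ∫ s in Ioi (0:ℝ), dd K s * (y ^ α * (ν (Ioi (y * s))).toReal)) atTop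
      (nhds (∫ s in Ioi (0:ℝ), dd K s * s ^ (-α))) := by
    have hrw : ∀ y > 0, ∀ s > 0, y ^ α * (ν (Ioi (y * s))).toReal =
        s ^ (-α) * ((y * s) ^ α * (ν (Ioi (y * s))).toReal) := by
      intro y hy s hs
      rw [Real.mul_rpow hy.le hs.le, Real.rpow_neg hs.le]
      have : s ^ α ≠ 0 := (Real.rpow_pos_of_pos hs α).ne'
      field_simp
    apply tendsto_integral_filter_of_dominated_convergence (fun s => (dd K s * s ^ (-α)) * C)
    · filter_upwards [eventually_gt_atTop 0] with y hy
      apply Measurable.aestronglyMeasurable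
      apply (dd_meas K).mul
      apply Measurable.const_mul
      apply Measurable.ennreal_toReal
      have : Antitone (fun s : ℝ => ν (Ioi (y * s))) := by
        intro s t hst
        exact measure_mono (Ioi_subset_Ioi (by gcongr))
      exact this.measurable
    · filter_upwards [eventually_gt_atTop 0] with y hy
      refine ae_restrict_of_forall_mem measurableSet_Ioi (fun s hs => ?_)
      have hs' : 0 < s := hs
      have hd := dd_nonneg K hs'.le
      rw [Real.norm_of_nonneg (by positivity), hrw y hy s hs, mul_assoc]
      gcongr
      exact hC _ (by positivity)
    · exact hi.mul_const C
    · refine ae_restrict_of_forall_mem measurableSet_Ioi (fun s hs => ?_)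
      have hs' : 0 < s := hs
      apply Tendsto.const_mul
      have t1 := (htail.comp (tendsto_id.atTop_mul_const hs')).const_mul (s ^ (-α))
      rw [mul_one] at t1
      refine t1.congr' ?_
      filter_upwards [eventually_gt_atTop 0] with y hy
      exact (hrw y hy s hs).symm
  refine hT.congr' ?_
  filter_upwards [eventually_gt_atTop 0] with y hy
  rw [GG_eq ν hsupp K hy, ← mul_assoc, ← integral_const_mul]
  congr 1; ext s
  rw [Real.rpow_sub_one hy.ne']
  field_simp

lemma fDef_eq (μ : ℝ) (n K : ℕ) (z : Fin (K + 2) → ℝ) (b u v : ℝ)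
    (hb : 1 ≤ b * b / (μ * n))
    (hz : ∀ i : Fin K, z (i.castSucc.castSucc) = b) (hu : z (Fin.last K).castSucc = u)
    (hv : z (Fin.last (K + 1)) = v) :
    fDef μ n (K + 2) z = min (b * u / (μ * n)) 1 ^ K * min (b * v / (μ * n)) 1 ^ K *
      min (u * v / (μ * n)) 1 := by
  unfold fDef
  rw [Finset.prod_filter, Fintype.prod_prod_type]
  simp only [Fin.prod_univ_castSucc, hz, hu, hv]
  have l1 : ∀ i : Fin K, i.castSucc.castSucc < (Fin.last K).castSucc := by
    intro i; simp [Fin.lt_def]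
  have l2 : ∀ i : Fin K, i.castSucc.castSucc < Fin.last (K + 1) := by
    intro i; simp only [Fin.lt_def, Fin.val_castSucc, Fin.val_last]; have := i.isLt; omega
  have l3 : (Fin.last K).castSucc < Fin.last (K + 1) := by
    simp [Fin.lt_def]
  simp only [l1, l2, l3, if_true, (l1 _).not_gt, (l2 _).not_gt, l3.not_gt, if_false, lt_irrefl,
    min_eq_right hb, ite_self, Finset.prod_const_one, Finset.prod_const, Finset.card_univ,
    Fintype.card_fin, one_mul, mul_one, mul_pow]

lemma prod_fin_two' (N : ℕ) (hN : N = 2) (f : Fin N → ℝ) :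
    ∏ i, f i = f ⟨0, by omega⟩ * f ⟨1, by omega⟩ := by
  subst hN; rw [Fin.prod_univ_two]; rfl

lemma SB_bounds (ν : Measure ℝ) [IsProbabilityMeasure ν] (hsupp : ν (Set.Iio 1) = 0)
    (hint : Integrable (fun x : ℝ => x) ν) (μ : ℝ) (hμ : 0 < μ) (K n : ℕ) (hn : 0 < n) (b : ℝ)
    (hb1 : 1 ≤ b) (hb : 1 ≤ b * b / (μ * n)) :
    SB ν μ (K + 2) K (fun _ => b) n ≤ 1 / (μ * n) * (GG ν K (μ * n / b)) ^ 2 ∧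
    1 / (μ * n) * (∫ w, (Iic (√(μ * n))).indicator (fun w => w * min (w / (μ * n / b)) 1 ^ K) w ∂ν) ^ 2
      ≤ SB ν μ (K + 2) K (fun _ => b) n := by
  have hn' : (0:ℝ) < n := by exact_mod_cast hn
  have hM : 0 < μ * n := by positivity
  set M := μ * n with hMdef
  have hb0 : 0 < b := by linarith
  have hN : K + 2 - K = 2 := by omega
  have hres : ν.restrict (Ici 1) = ν := by
    apply Measure.restrict_eq_self_of_ae_mem
    rw [ae_iff]
    convert hsupp using 2
    ext x; simp
  set φ : ℝ → ℝ := fun w => w * min (w / (M / b)) 1 ^ K with hφ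
  have hφm : Measurable φ := by fun_prop
  have hφ0 : ∀ w, 0 ≤ w → 0 ≤ φ w := fun w hw => by simp only [hφ]; positivity
  have hφle : ∀ w, 0 ≤ w → φ w ≤ w := fun w hw => by
    simp only [hφ]
    have : min (w / (M / b)) 1 ^ K ≤ 1 := pow_le_one₀ (by positivity) (min_le_right _ _)
    nlinarith
  have hφi : Integrable φ ν := by
    refine hint.mono' hφm.aestronglyMeasurable ?_
    rw [← hres]
    refine ae_restrict_of_forall_mem measurableSet_Ici (fun w hw => ?_)
    have : (0:ℝ) ≤ w := le_trans zero_le_one hw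
    rw [Real.norm_of_nonneg (hφ0 w this)]
    exact hφle w this
  have hS : MeasurableSet (Set.univ.pi (fun _ : Fin (K + 2 - K) => Set.Ici (1 : ℝ))) :=
    MeasurableSet.univ_pi (fun _ => measurableSet_Ici)
  have hform : SB ν μ (K + 2) K (fun _ => b) n = 
      ∫ x in Set.univ.pi (fun _ : Fin (K + 2 - K) => Set.Ici (1 : ℝ)),
        min (b * x ⟨0, by omega⟩ / M) 1 ^ K * min (b * x ⟨1, by omega⟩ / M) 1 ^ K *
          min (x ⟨0, by omega⟩ * x ⟨1, by omega⟩ / M) 1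
        ∂(Measure.pi fun _ : Fin (K + 2 - K) => ν) := by
    unfold SB
    congr 1
    ext x
    apply fDef_eq μ n K _ b _ _ hb
    · intro i; simp
    · simp
    · simp
  have hprod : ∀ ψ : ℝ → ℝ, ∫ x in Set.univ.pi (fun _ : Fin (K + 2 - K) => Set.Ici (1 : ℝ)),
        (1 / M) * ∏ i, ψ (x i) ∂(Measure.pi fun _ : Fin (K + 2 - K) => ν)
        = 1 / M * (∫ w, ψ w ∂ν) ^ 2 := by
    intro ψ
    rw [Measure.restrict_pi_pi, hres, integral_const_mul,
      integral_fintype_prod_eq_prod (fun _ => ψ)]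
    simp [hN]
  have hpi : ∀ ψ : ℝ → ℝ, Integrable ψ ν → Integrable (fun x : Fin (K + 2 - K) → ℝ => (1 / M) * ∏ i, ψ (x i))
      ((Measure.pi fun _ : Fin (K + 2 - K) => ν).restrict
        (Set.univ.pi (fun _ : Fin (K + 2 - K) => Set.Ici (1 : ℝ)))) := by
    intro ψ hψ
    apply Integrable.const_mul
    apply Integrable.restrict
    exact Integrable.fintype_prod (fun _ => hψ)
  have hcomm : ∀ w : ℝ, b * w / M = w / (M / b) := fun w => by field_simp
  constructor
  · rw [hform]
    unfold GG
    rw [← hprod]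
    refine integral_mono_of_nonneg ?_ (hpi _ hφi) ?_
    · refine ae_restrict_of_forall_mem hS (fun x hx => ?_)
      have x0 : 0 < x ⟨0, by omega⟩ := lt_of_lt_of_le one_pos (hx _ (mem_univ _))
      have x1 : 0 < x ⟨1, by omega⟩ := lt_of_lt_of_le one_pos (hx _ (mem_univ _))
      simp only [Pi.zero_apply]
      positivity
    · refine ae_restrict_of_forall_mem hS (fun x hx => ?_)
      have x0 : 0 < x ⟨0, by omega⟩ := lt_of_lt_of_le one_pos (hx _ (mem_univ _))
      have x1 : 0 < x ⟨1, by omega⟩ := lt_of_lt_of_le one_pos (hx _ (mem_univ _))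
      simp only
      rw [prod_fin_two' _ hN]
      generalize x ⟨0, by omega⟩ = u at *
      generalize x ⟨1, by omega⟩ = v at *
      simp only [hφ, hcomm]
      calc _ ≤ min (u / (M / b)) 1 ^ K * min (v / (M / b)) 1 ^ K * (u * v / M) := by
            gcongr; exact min_le_left _ _
        _ = _ := by ring
  · rw [hform, ← hprod]
    refine integral_mono_of_nonneg ?_ ?_ ?_
    · refine ae_restrict_of_forall_mem hS (fun x hx => ?_)
      simp only [Pi.zero_apply]
      refine mul_nonneg (by positivity) (Finset.prod_nonneg fun i _ => ?_)
      apply indicator_apply_nonneg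
      intro _
      exact hφ0 _ (le_trans zero_le_one (hx i (mem_univ i)))
    · refine Integrable.of_bound (C := 1) (Measurable.aestronglyMeasurable (by fun_prop)) ?_
      refine ae_restrict_of_forall_mem hS (fun x hx => ?_)
      have x0 : 0 < x ⟨0, by omega⟩ := lt_of_lt_of_le one_pos (hx _ (mem_univ _))
      have x1 : 0 < x ⟨1, by omega⟩ := lt_of_lt_of_le one_pos (hx _ (mem_univ _))
      rw [Real.norm_of_nonneg (by positivity)]
      refine mul_le_one₀ (mul_le_one₀ (pow_le_one₀ (by positivity) (min_le_right _ _)) (by positivity)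
        (pow_le_one₀ (by positivity) (min_le_right _ _))) (by positivity) (min_le_right _ _)
    · refine ae_restrict_of_forall_mem hS (fun x hx => ?_)
      have x0 : 0 < x ⟨0, by omega⟩ := lt_of_lt_of_le one_pos (hx _ (mem_univ _))
      have x1 : 0 < x ⟨1, by omega⟩ := lt_of_lt_of_le one_pos (hx _ (mem_univ _))
      simp only
      rw [prod_fin_two' _ hN]
      generalize x ⟨0, by omega⟩ = u at *
      generalize x ⟨1, by omega⟩ = v at *
      by_cases hu : u ≤ √M
      · by_cases hv : v ≤ √M
        · rw [indicator_of_mem (s := Iic (√M)) (a := u) hu, indicator_of_mem (s := Iic (√M)) (a := v) hv]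
          have huv : u * v / M ≤ 1 := by
            rw [div_le_one hM]
            calc u * v ≤ √M * √M := by gcongr
              _ = M := Real.mul_self_sqrt hM.le
          rw [min_eq_left huv]
          simp only [hφ, hcomm]
          apply le_of_eq; ring
        · rw [indicator_of_notMem (s := Iic (√M)) (a := v) hv, mul_zero, mul_zero]; positivity
      · rw [indicator_of_notMem (s := Iic (√M)) (a := u) hu, zero_mul, mul_zero]; positivity

lemma L_bounds (ν : Measure ℝ) [IsProbabilityMeasure ν] (hsupp : ν (Set.Iio 1) = 0)
    (hint : Integrable (fun x : ℝ => x) ν) (K : ℕ) (y R : ℝ) (hy : 0 < y) (hR : 0 < R) :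
    GG ν K y - GG ν K R ≤ ∫ w, (Iic R).indicator (fun w => w * min (w / y) 1 ^ K) w ∂ν ∧
    ∫ w, (Iic R).indicator (fun w => w * min (w / y) 1 ^ K) w ∂ν ≤ GG ν K y := by
  have hpos : ∀ᵐ w ∂ν, (0:ℝ) ≤ w := by
    rw [ae_iff]
    refine measure_mono_null ?_ hsupp
    intro x hx
    simp only [mem_ofPred_eq, not_le] at hx
    simp only [mem_Iio]; linarith
  have hi : ∀ y > 0, Integrable (fun w : ℝ => w * min (w / y) 1 ^ K) ν := by
    intro y hy
    refine hint.mono' (Measurable.aestronglyMeasurable (by fun_prop)) ?_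
    filter_upwards [hpos] with w hw
    rw [Real.norm_of_nonneg (by positivity)]
    have : min (w / y) 1 ^ K ≤ 1 := pow_le_one₀ (by positivity) (min_le_right _ _)
    nlinarith
  have hI := (hi y hy).indicator (measurableSet_Iic (a := R))
  unfold GG
  constructor
  · rw [← integral_sub (hi y hy) (hi R hR)]
    refine integral_mono_ae ((hi y hy).sub (hi R hR)) hI ?_
    filter_upwards [hpos] with w hw
    by_cases h : w ≤ R
    · rw [indicator_of_mem (s := Iic R) h]
      have : 0 ≤ w * min (w / R) 1 ^ K := by positivity
      linarith
    · rw [indicator_of_notMem (s := Iic R) h]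
      have h1 : 1 ≤ w / R := by rw [le_div_iff₀ hR]; linarith
      rw [min_eq_right h1]
      have : min (w / y) 1 ^ K ≤ 1 := pow_le_one₀ (by positivity) (min_le_right _ _)
      simp only [one_pow]
      nlinarith
  · refine integral_mono_ae hI (hi y hy) ?_
    filter_upwards [hpos] with w hw
    by_cases h : w ≤ R
    · rw [indicator_of_mem (s := Iic R) h]
    · rw [indicator_of_notMem (s := Iic R) h]; positivity

/-- for `k-2` equal hubs `b(n)` with `n^{θ₁} ≤ b(n) ≤ n^{θ₂}`,
`1/2 < θ₁ ≤ θ₂ < 1`,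
`S_B^{(k-2)}(n) = (1+o(1)) (1/(μn)) (α(k-2)/((α-1)(k-α-1)))² (b(n)/(μn))^{2(α-1)}`. -/
theorem stmt7
    (α : ℝ) (hα : α ∈ Set.Ioo (1 : ℝ) 2)
    (ν : Measure ℝ) [IsProbabilityMeasure ν]
    (hsupp : ν (Set.Iio 1) = 0)
    (htail : Tendsto (fun x : ℝ => x ^ α * (ν (Set.Ioi x)).toReal) atTop (nhds 1))
    (g : ℝ → ℝ)
    (hdens : ν = MeasureTheory.volume.withDensity (fun x => ENNReal.ofReal (g x)))
    (hgtail : Tendsto (fun x : ℝ => g x * x ^ (α + 1)) atTop (nhds α))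
    (hint : Integrable (fun x : ℝ => x) ν)
    (μ : ℝ) (hμ : μ = ∫ x, x ∂ν)
    (k : ℕ) (hk : 3 ≤ k)
    (b : ℕ → ℝ) (hbval : ∀ m, 1 ≤ b m)
    (θ₁ θ₂ : ℝ) (hθ₁ : 1 / 2 < θ₁) (hθ₁₂ : θ₁ ≤ θ₂) (hθ₂ : θ₂ < 1)
    (hb : ∀ᶠ n : ℕ in atTop, (n : ℝ) ^ θ₁ ≤ b n ∧ b n ≤ (n : ℝ) ^ θ₂) :
    Tendsto (fun n : ℕ =>
        SB ν μ k (k - 2) (fun _ => b n) n /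
          (1 / (μ * n) * (α * ((k : ℝ) - 2) / ((α - 1) * ((k : ℝ) - α - 1))) ^ 2 *
            (b n / (μ * n)) ^ (2 * (α - 1))))
      atTop (nhds 1) := by
  obtain ⟨h1, h2⟩ := hα
  obtain ⟨K, rfl⟩ : ∃ K, k = K + 2 := ⟨k - 2, by omega⟩
  have hK : 1 ≤ K := by omega
  have hK' : (1:ℝ) ≤ K := by exact_mod_cast hK
  have hμ1 : 1 ≤ μ := by
    have hone : ∀ᵐ w ∂ν, (1:ℝ) ≤ w := by
      rw [ae_iff]
      convert hsupp using 2
      ext x; simp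
    have := integral_mono_ae (integrable_const (1:ℝ)) hint hone
    rw [hμ]
    simpa using this
  have hμ0 : 0 < μ := by linarith
  have hG := GG_tendsto α h1 h2 ν hsupp htail K hK
  set C : ℝ := α * K / ((α - 1) * (K + 1 - α)) with hC
  have hC0 : 0 < C := by
    rw [hC]
    have : 0 < α - 1 := by linarith
    have : 0 < (K:ℝ) + 1 - α := by linarith
    positivity
  have hCe : α * (((K + 2 : ℕ) : ℝ) - 2) / ((α - 1) * (((K + 2 : ℕ) : ℝ) - α - 1)) = C := by
    rw [hC]; push_cast; congr 1
    · ring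
    · ring
  rw [hCe]
  change Tendsto (fun n : ℕ => SB ν μ (K + 2) K (fun _ => b n) n / _) atTop (nhds 1)
  have hcast : Tendsto (fun n : ℕ => (n : ℝ)) atTop atTop := tendsto_natCast_atTop_atTop
  have hb0 : ∀ n, 0 < b n := fun n => by linarith [hbval n]
  -- the scale y(n)
  have hy : Tendsto (fun n : ℕ => μ * n / b n) atTop atTop := by
    have t : Tendsto (fun n : ℕ => μ * (n:ℝ) ^ (1 - θ₂)) atTop atTop :=
      ((tendsto_rpow_atTop (by linarith)).comp hcast).const_mul_atTop hμ0
    refine tendsto_atTop_mono' _ ?_ t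
    filter_upwards [hb, eventually_gt_atTop 0] with n hn hn0
    have hn' : (0:ℝ) < n := by exact_mod_cast hn0
    rw [le_div_iff₀ (hb0 n)]
    calc μ * (n:ℝ) ^ (1 - θ₂) * b n ≤ μ * (n:ℝ) ^ (1 - θ₂) * (n:ℝ) ^ θ₂ := by
          gcongr; exact hn.2
      _ = μ * n := by rw [mul_assoc, ← Real.rpow_add hn']; simp
  have hR : Tendsto (fun n : ℕ => √(μ * n)) atTop atTop :=
    Real.tendsto_sqrt_atTop.comp (hcast.const_mul_atTop hμ0)
  have hq : Tendsto (fun n : ℕ => √(μ * n) / b n) atTop (nhds 0) := by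
    have t : Tendsto (fun n : ℕ => √μ * (n:ℝ) ^ (-(θ₁ - 1 / 2))) atTop (nhds (√μ * 0)) :=
      ((tendsto_rpow_neg_atTop (by linarith)).comp hcast).const_mul _
    rw [mul_zero] at t
    refine squeeze_zero' (Eventually.of_forall fun n => by have := hb0 n; positivity) ?_ t
    filter_upwards [hb, eventually_gt_atTop 0] with n hn hn0
    have hn' : (0:ℝ) < n := by exact_mod_cast hn0
    rw [div_le_iff₀ (hb0 n), Real.sqrt_mul hμ0.le]
    calc √μ * √(n:ℝ) = √μ * (n:ℝ) ^ (-(θ₁ - 1 / 2)) * (n:ℝ) ^ θ₁ := by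
          rw [mul_assoc, ← Real.rpow_add hn', Real.sqrt_eq_rpow (n:ℝ)]; congr 2; ring
      _ ≤ _ := by gcongr; exact hn.1
  have hb2 : ∀ᶠ n : ℕ in atTop, 1 ≤ b n * b n / (μ * n) := by
    filter_upwards [hq.eventually (eventually_le_nhds one_pos), eventually_gt_atTop 0] with n hn hn0
    have hn' : (0:ℝ) < n := by exact_mod_cast hn0
    rw [div_le_one (hb0 n)] at hn
    rw [le_div_iff₀ (by positivity), one_mul, ← Real.mul_self_sqrt (show 0 ≤ μ * n by positivity)]
    exact mul_le_mul hn hn (Real.sqrt_nonneg _) (hb0 n).le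
  have hGy := hG.comp hy
  have hGR : Tendsto (fun n : ℕ => (μ * n / b n) ^ (α - 1) * GG ν K (√(μ * n))) atTop (nhds 0) := by
    have t1 : Tendsto (fun n : ℕ => (√(μ * n) / b n) ^ (α - 1)) atTop (nhds 0) := by
      have := hq.rpow_const (p := α - 1) (Or.inr (by linarith))
      rwa [Real.zero_rpow (by linarith)] at this
    have t2 := t1.mul (hG.comp hR)
    rw [zero_mul] at t2
    refine t2.congr' ?_
    filter_upwards [eventually_gt_atTop 0] with n hn0
    have hn' : (0:ℝ) < n := by exact_mod_cast hn0
    have := hb0 n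
    simp only [Function.comp]
    rw [← mul_assoc, ← Real.mul_rpow (by positivity) (by positivity)]
    congr 2
    rw [div_mul_eq_mul_div, Real.mul_self_sqrt (by positivity)]
  have hL : Tendsto (fun n : ℕ => (μ * n / b n) ^ (α - 1) * ∫ w, (Iic (√(μ * n))).indicator
      (fun w => w * min (w / (μ * n / b n)) 1 ^ K) w ∂ν) atTop (nhds C) := by
    have t := hGy.sub hGR
    rw [sub_zero] at t
    refine tendsto_of_tendsto_of_tendsto_of_le_of_le' t hGy ?_ ?_
    · filter_upwards [eventually_gt_atTop 0] with n hn0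
      have hn' : (0:ℝ) < n := by exact_mod_cast hn0
      have := hb0 n
      simp only [Function.comp]
      rw [← mul_sub]
      gcongr
      exact (L_bounds ν hsupp hint K _ _ (by positivity) (by positivity)).1
    · filter_upwards [eventually_gt_atTop 0] with n hn0
      have hn' : (0:ℝ) < n := by exact_mod_cast hn0
      have := hb0 n
      simp only [Function.comp]
      gcongr
      exact (L_bounds ν hsupp hint K _ _ (by positivity) (by positivity)).2
  have hsq : ∀ f : ℕ → ℝ, Tendsto f atTop (nhds C) → Tendsto (fun n => f n ^ 2 / C ^ 2) atTop (nhds 1) := by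
    intro f hf
    have := (hf.pow 2).div_const (C ^ 2)
    rwa [div_self (by positivity)] at this
  have hid : ∀ n : ℕ, 0 < n → ∀ X : ℝ, ((μ * n / b n) ^ (α - 1) * X) ^ 2 / C ^ 2 =
      (1 / (μ * n) * X ^ 2) / (1 / (μ * n) * C ^ 2 * (b n / (μ * n)) ^ (2 * (α - 1))) := by
    intro n hn0 X
    have hn' : (0:ℝ) < n := by exact_mod_cast hn0
    have := hb0 n
    have e : (b n / (μ * n)) ^ (2 * (α - 1)) = (((μ * n / b n) ^ (α - 1)) ^ 2)⁻¹ := by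
      rw [← inv_div (μ * n) (b n), Real.inv_rpow (by positivity), mul_comm 2 (α - 1),
        Real.rpow_mul (by positivity), Real.rpow_two]
    rw [e]
    have hp : 0 < (μ * n / b n) ^ (α - 1) := by positivity
    generalize (μ * n / b n) ^ (α - 1) = p at *
    field_simp
  refine tendsto_of_tendsto_of_tendsto_of_le_of_le' (hsq _ hL) (hsq _ hGy) ?_ ?_
  · filter_upwards [hb2, eventually_gt_atTop 0] with n hn hn0
    have hn' : (0:ℝ) < n := by exact_mod_cast hn0
    have := hb0 n
    rw [hid n hn0]
    gcongr
    exact (SB_bounds ν hsupp hint μ hμ0 K n hn0 (b n) (hbval n) hn).2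
  · filter_upwards [hb2, eventually_gt_atTop 0] with n hn hn0
    have hn' : (0:ℝ) < n := by exact_mod_cast hn0
    have := hb0 n
    simp only [Function.comp]
    rw [hid n hn0]
    gcongr
    exact (SB_bounds ν hsupp hint μ hμ0 K n hn0 (b n) (hbval n) hn).1
end
end

section
/- Assume α > 2 − 2/k and let a > 0. Then for every integer i with 1 ≤ i < k−2 there exists ε > 0 such that P( C_n > (1+a) · m_n^{(k)} and L_n(ε · c_a(n)) = i ) = O( (n · P(W > c_a(n)))^{k−2} ) as n → ∞. -/
open MeasureTheory Filter Set

noncomputable section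

/-- Expected `k`-clique count `m_n^{(k)}`. -/
def mExp (ν : Measure ℝ) (μ : ℝ) (k n : ℕ) : ℝ :=
  (n.choose k : ℝ) *
    ∫ x in Set.univ.pi (fun _ : Fin k => Set.Ici (1 : ℝ)),
      fDef μ n k x ∂(Measure.pi fun _ : Fin k => ν)

/-- The weight vector `(x, y, c, …, c)`. -/
def hubVec (k : ℕ) (x y c : ℝ) : Fin k → ℝ :=
  fun i => if i.val = 0 then x else if i.val = 1 then y else c

/-- `∫∫ f_n(x, y, c, …, c) dF(x) dF(y)`. -/
def twoInt (ν : Measure ℝ) (μ : ℝ) (k n : ℕ) (c : ℝ) : ℝ :=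
  ∫ x in Set.Ici (1 : ℝ), ∫ y in Set.Ici (1 : ℝ),
    fDef μ n k (hubVec k x y c) ∂ν ∂ν

/-- `c_a(n)`, the smallest hub size creating an expected excess of `a m_n^{(k)}` cliques. -/
def cA (ν : Measure ℝ) (μ : ℝ) (k : ℕ) (a : ℝ) (n : ℕ) : ℝ :=
  sInf {c : ℝ | 0 < c ∧ a * mExp ν μ k n < (n.choose 2 : ℝ) * twoInt ν μ k n c}

/-- `C_n`, the conditional expectation given the weights of the number of `k`-cliques. -/
def Cful (μ : ℝ) (k n : ℕ) (w : Fin n → ℝ) : ℝ :=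
  ∑ S ∈ Finset.powersetCard k (Finset.univ : Finset (Fin n)),
    ∏ p ∈ Finset.univ.filter (fun p : Fin n × Fin n => p.1 ∈ S ∧ p.2 ∈ S ∧ p.1 < p.2),
      min (w p.1 * w p.2 / (μ * n)) 1

/-- `L_n(z) = #{i ≤ n : W_i > z}`. -/
def Ln {n : ℕ} (z : ℝ) (w : Fin n → ℝ) : ℕ :=
  (Finset.univ.filter (fun i : Fin n => z < w i)).card

set_option linter.unusedVariables false



lemma prod_lt_sq {ι : Type*} [LinearOrder ι] (S : Finset ι) (g : ι → ι → ℝ)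
    (hg : ∀ i j, g i j = g j i) :
    (∏ p ∈ S.offDiag.filter (fun p => p.1 < p.2), g p.1 p.2) ^ 2
      = ∏ p ∈ S.offDiag, g p.1 p.2 := by
  rw [← Finset.prod_filter_mul_prod_filter_not S.offDiag (fun p => p.1 < p.2), sq]
  congr 1
  refine Finset.prod_nbij' Prod.swap Prod.swap ?_ ?_ ?_ ?_ ?_
  · rintro ⟨x, y⟩ h
    simp only [Finset.mem_filter, Finset.mem_offDiag, Prod.swap] at h ⊢
    refine ⟨⟨h.1.2.1, h.1.1, fun e => h.1.2.2 e.symm⟩, not_lt.2 h.2.le⟩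
  · rintro ⟨x, y⟩ h
    simp only [Finset.mem_filter, Finset.mem_offDiag, Prod.swap] at h ⊢
    refine ⟨⟨h.1.2.1, h.1.1, fun e => h.1.2.2 e.symm⟩, lt_of_le_of_ne (not_lt.1 h.2) (fun e => h.1.2.2 e.symm)⟩
  · simp
  · simp
  · rintro ⟨x, y⟩ _
    exact hg x y

/-- the edge probability -/
def mm (μ : ℝ) (n : ℕ) (x y : ℝ) : ℝ := min (x * y / (μ * n)) 1

lemma mm_comm (μ : ℝ) (n : ℕ) (x y : ℝ) : mm μ n x y = mm μ n y x := by
  unfold mm; rw [mul_comm]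

lemma mm_le_one (μ : ℝ) (n : ℕ) (x y : ℝ) : mm μ n x y ≤ 1 := min_le_right _ _

lemma mm_nonneg {μ : ℝ} (hμ : 0 < μ) (n : ℕ) {x y : ℝ} (hx : 0 ≤ x) (hy : 0 ≤ y) :
    0 ≤ mm μ n x y := by
  unfold mm
  refine le_min ?_ zero_le_one
  positivity

lemma mm_mono {μ : ℝ} (hμ : 0 < μ) (n : ℕ) {x y x' y' : ℝ} (hx : 0 ≤ x) (hy : 0 ≤ y)
    (hxx : x ≤ x') (hyy : y ≤ y') :
    mm μ n x y ≤ mm μ n x' y' := by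
  unfold mm
  refine min_le_min ?_ le_rfl
  gcongr
  linarith

lemma fDef_nonneg {μ : ℝ} (hμ : 0 < μ) (n k : ℕ) {x : Fin k → ℝ} (hx : ∀ i, 0 ≤ x i) :
    0 ≤ fDef μ n k x := by
  unfold fDef
  exact Finset.prod_nonneg fun p _ => mm_nonneg hμ n (hx _) (hx _)

lemma fDef_le_one {μ : ℝ} (hμ : 0 < μ) (n k : ℕ) {x : Fin k → ℝ} (hx : ∀ i, 0 ≤ x i) :
    fDef μ n k x ≤ 1 := by
  unfold fDef
  exact Finset.prod_le_one (fun p _ => mm_nonneg hμ n (hx _) (hx _)) (fun p _ => mm_le_one _ _ _ _)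

lemma fDef_mono {μ : ℝ} (hμ : 0 < μ) (n k : ℕ) {x y : Fin k → ℝ} (hx : ∀ i, 0 ≤ x i)
    (hxy : ∀ i, x i ≤ y i) :
    fDef μ n k x ≤ fDef μ n k y := by
  unfold fDef
  exact Finset.prod_le_prod (fun p _ => mm_nonneg hμ n (hx _) (hx _))
    (fun p _ => mm_mono hμ n (hx _) (hx _) (hxy _) (hxy _))

lemma fDef_sq (μ : ℝ) (n k : ℕ) (x : Fin k → ℝ) :
    fDef μ n k x ^ 2 = ∏ p ∈ (Finset.univ : Finset (Fin k)).offDiag, mm μ n (x p.1) (x p.2) := by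
  rw [← prod_lt_sq _ (fun i j => mm μ n (x i) (x j)) (fun i j => mm_comm _ _ _ _)]
  unfold fDef mm
  congr 2
  ext ⟨p, q⟩
  simp
  intro h; exact h.ne

/-- restriction to a subset of the vertices. -/
lemma fDef_sq_le {μ : ℝ} (hμ : 0 < μ) (n k : ℕ) {x : Fin k → ℝ} (hx : ∀ i, 0 ≤ x i)
    (P : Finset (Fin k)) :
    fDef μ n k x ^ 2 ≤ ∏ p ∈ P.offDiag, mm μ n (x p.1) (x p.2) := by
  rw [fDef_sq]
  rw [← Finset.prod_sdiff (Finset.offDiag_mono (Finset.subset_univ P))]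
  refine mul_le_of_le_one_left (Finset.prod_nonneg fun p _ => mm_nonneg hμ n (hx _) (hx _)) ?_
  exact Finset.prod_le_one (fun p _ => mm_nonneg hμ n (hx _) (hx _)) (fun p _ => mm_le_one _ _ _ _)

lemma fDef_tri {μ : ℝ} (hμ : 0 < μ) (n k : ℕ) {x : Fin k → ℝ} (hx : ∀ i, 0 ≤ x i)
    {i j l : Fin k} (hij : i ≠ j) (hil : i ≠ l) (hjl : j ≠ l) :
    fDef μ n k x ≤ mm μ n (x i) (x j) * mm μ n (x i) (x l) * mm μ n (x j) (x l) := by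
  have h := fDef_sq_le hμ n k hx {i, j, l}
  have h0 : ∀ a b, 0 ≤ mm μ n (x a) (x b) := fun a b => mm_nonneg hμ n (hx _) (hx _)
  refine le_of_sq_le_sq ?_ (by have := h0 i j; have := h0 i l; have := h0 j l; positivity)
  refine h.trans (le_of_eq ?_)
  have e : ({i, j, l} : Finset (Fin k)).offDiag
      = {(i, j), (i, l), (j, i), (j, l), (l, i), (l, j)} := by
    ext ⟨a, b⟩
    simp only [Finset.mem_offDiag, Finset.mem_insert, Finset.mem_singleton, Prod.mk.injEq]
    grind
  rw [e]
  rw [Finset.prod_insert, Finset.prod_insert, Finset.prod_insert, Finset.prod_insert,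
    Finset.prod_insert, Finset.prod_singleton]
  · rw [mm_comm μ n (x j) (x i), mm_comm μ n (x l) (x i), mm_comm μ n (x l) (x j)]
    ring
  all_goals simp [Prod.ext_iff]; grind

/-- two-regime power function -/
def phi (s t u : ℝ) : ℝ := if u ≤ 1 then u ^ s else u ^ t

lemma phi_nonneg (s t : ℝ) {u : ℝ} (hu : 0 ≤ u) : 0 ≤ phi s t u := by
  unfold phi; split_ifs <;> positivity

lemma phi_mono {s t : ℝ} (hs : 0 ≤ s) (ht : 0 ≤ t) {u v : ℝ} (hu : 0 ≤ u) (huv : u ≤ v) :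
    phi s t u ≤ phi s t v := by
  unfold phi
  split_ifs with h1 h2 h2
  · exact Real.rpow_le_rpow hu huv hs
  · exact (Real.rpow_le_one hu h1 hs).trans (Real.one_le_rpow (not_le.1 h2).le ht)
  · exact absurd (huv.trans h2) h1
  · exact Real.rpow_le_rpow hu huv ht

lemma phi_theta {ι : Type*} [LinearOrder ι] (P : Finset ι) (hP : 3 ≤ P.card) (u : ι → ℝ)
    (hu : ∀ i, 0 < u i) {α : ℝ} (h1 : 1 < α) (h2 : α < 2) {ζ : ℝ} (hζ : ζ = (2 - α) / 7) :
    ∏ p ∈ P.offDiag, min (u p.1 * u p.2) 1 ≤ (∏ i ∈ P, phi (α + ζ) (α - ζ) (u i)) ^ 2 := by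
  classical
  set e : ι → ℝ := fun i => if u i ≤ 1 then ζ else -ζ with he
  set E : ℝ := ∑ i ∈ P, e i with hE
  set q : ℝ := (P.card : ℝ) with hq
  have hq3 : (3 : ℝ) ≤ q := by rw [hq]; exact_mod_cast hP
  have hζ0 : 0 < ζ := by rw [hζ]; linarith
  have habs : ∀ i, |e i| ≤ ζ := by
    intro i; simp only [he]; split_ifs <;> simp [abs_of_pos hζ0]
  have hEabs : |E| ≤ q * ζ := by
    calc |E| ≤ ∑ i ∈ P, |e i| := Finset.abs_sum_le_sum_abs _ _
      _ ≤ ∑ i ∈ P, ζ := Finset.sum_le_sum fun i _ => habs i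
      _ = q * ζ := by simp [hq]
  set θ : ι → ι → ℝ := fun i j => α / (q - 1) + (e i + e j - E / (q - 1)) / (q - 2) with hθ
  have hq1 : 0 < q - 1 := by linarith
  have hq2 : 0 < q - 2 := by linarith
  have hbd : ∀ i j, |(e i + e j - E / (q - 1)) / (q - 2)| ≤ 7 * ζ / (q - 1) := by
    intro i j
    rw [abs_div, abs_of_pos hq2, div_le_div_iff₀ hq2 hq1]
    have a1 : |e i + e j - E / (q - 1)| ≤ ζ + ζ + q * ζ / (q - 1) := by
      refine (abs_sub _ _).trans ?_
      rw [abs_div, abs_of_pos hq1]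
      gcongr
      exact (abs_add_le _ _).trans (add_le_add (habs i) (habs j))
    have a2 : (ζ + ζ + q * ζ / (q - 1)) * (q - 1) = (3 * q - 2) * ζ := by
      field_simp; ring
    calc _ ≤ (ζ + ζ + q * ζ / (q - 1)) * (q - 1) := by gcongr
      _ = (3 * q - 2) * ζ := a2
      _ ≤ _ := by nlinarith
  have hθ0 : ∀ i j, 0 ≤ θ i j := by
    intro i j
    have := (abs_le.1 (hbd i j)).1
    have h3 : 7 * ζ / (q - 1) ≤ α / (q - 1) := by gcongr; rw [hζ]; linarith
    simp only [hθ]; linarith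
  have hθ1 : ∀ i j, θ i j ≤ 1 := by
    intro i j
    have := (abs_le.1 (hbd i j)).2
    have h3 : α / (q - 1) + 7 * ζ / (q - 1) ≤ 1 := by
      rw [← add_div, div_le_one hq1, hζ]; linarith
    simp only [hθ]; linarith
  have hsum : ∀ i ∈ P, ∑ j ∈ P.erase i, θ i j = α + e i := by
    intro i hi
    have c1 : ((P.erase i).card : ℝ) = q - 1 := by
      rw [Finset.card_erase_of_mem hi, Nat.cast_sub (by omega), hq]; simp
    have c2 : ∑ j ∈ P.erase i, e j = E - e i := by
      rw [hE, ← Finset.add_sum_erase P e hi]; ring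
    have : ∑ j ∈ P.erase i, θ i j = ∑ j ∈ P.erase i, ((α / (q - 1) + (e i - E / (q - 1)) / (q - 2))
        + e j / (q - 2)) := Finset.sum_congr rfl fun j _ => by simp only [hθ]; ring
    rw [this, Finset.sum_add_distrib, Finset.sum_const, nsmul_eq_mul, c1, ← Finset.sum_div, c2]
    field_simp; ring
  have hphi : ∀ i, phi (α + ζ) (α - ζ) (u i) = u i ^ (α + e i) := by
    intro i; simp only [phi, he]; split_ifs <;> rfl
  have key : ∏ p ∈ P.offDiag, (u p.1) ^ (θ p.1 p.2) = ∏ i ∈ P, phi (α + ζ) (α - ζ) (u i) := by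
    have e2 : ∏ p ∈ P.offDiag, (u p.1) ^ (θ p.1 p.2) = ∏ i ∈ P, ∏ j ∈ P.erase i, u i ^ θ i j := by
      rw [Finset.prod_sigma']
      refine Finset.prod_nbij' (fun p => ⟨p.1, p.2⟩) (fun p => (p.1, p.2)) ?_ ?_ ?_ ?_ ?_
      · rintro ⟨a, b⟩ h; simp only [Finset.mem_offDiag, Finset.mem_sigma, Finset.mem_erase, Prod.swap, ne_eq] at h ⊢; tauto
      · rintro ⟨a, b⟩ h; simp only [Finset.mem_offDiag, Finset.mem_sigma, Finset.mem_erase, Prod.swap, ne_eq] at h ⊢; tauto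
      · simp
      · simp
      · simp
    rw [e2]
    refine Finset.prod_congr rfl fun i hi => ?_
    rw [hphi, ← hsum i hi, Real.rpow_sum_of_pos (hu i)]
  have key2 : ∏ p ∈ P.offDiag, (u p.2) ^ (θ p.1 p.2) = ∏ i ∈ P, phi (α + ζ) (α - ζ) (u i) := by
    rw [← key]
    refine Finset.prod_nbij' Prod.swap Prod.swap ?_ ?_ ?_ ?_ ?_
    · rintro ⟨x, y⟩ h; simp only [Finset.mem_offDiag, Finset.mem_sigma, Finset.mem_erase, Prod.swap, ne_eq] at h ⊢; tauto
    · rintro ⟨x, y⟩ h; simp only [Finset.mem_offDiag, Finset.mem_sigma, Finset.mem_erase, Prod.swap, ne_eq] at h ⊢; tauto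
    · simp
    · simp
    · rintro ⟨x, y⟩ _
      simp only [hθ, Prod.swap]; congr 2; ring
  calc ∏ p ∈ P.offDiag, min (u p.1 * u p.2) 1
      ≤ ∏ p ∈ P.offDiag, ((u p.1) ^ (θ p.1 p.2) * (u p.2) ^ (θ p.1 p.2)) := by
        refine Finset.prod_le_prod (fun p _ => le_min (mul_pos (hu _) (hu _)).le zero_le_one) ?_
        intro p _
        rw [← Real.mul_rpow (hu _).le (hu _).le]
        have hpos := mul_pos (hu p.1) (hu p.2)
        rcases le_total (u p.1 * u p.2) 1 with h | h
        · rw [min_eq_left h]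
          calc u p.1 * u p.2 = (u p.1 * u p.2) ^ (1 : ℝ) := (Real.rpow_one _).symm
            _ ≤ _ := Real.rpow_le_rpow_of_exponent_ge hpos h (hθ1 _ _)
        · rw [min_eq_right h]
          exact Real.one_le_rpow h (hθ0 _ _)
    _ = _ := by rw [Finset.prod_mul_distrib, key, key2, sq]

/-- The clique function is dominated by a product. -/
lemma fDef_le_phi {μ : ℝ} (hμ : 0 < μ) {n k : ℕ} (hn : 0 < n) {x : Fin k → ℝ} (hx : ∀ i, 0 < x i)
    (P : Finset (Fin k)) (hP : 3 ≤ P.card) {α : ℝ} (h1 : 1 < α) (h2 : α < 2) {ζ : ℝ}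
    (hζ : ζ = (2 - α) / 7) :
    fDef μ n k x ≤ ∏ i ∈ P, phi (α + ζ) (α - ζ) (x i / √(μ * n)) := by
  have hn' : (0 : ℝ) < n := by exact_mod_cast hn
  have hpos : 0 < √(μ * n) := by positivity
  have h := fDef_sq_le hμ n k (fun i => (hx i).le) P
  have h' := phi_theta P hP (fun i => x i / √(μ * n)) (fun i => div_pos (hx i) hpos) h1 h2 hζ
  refine le_of_sq_le_sq (h.trans (le_trans (le_of_eq ?_) h'))
    (Finset.prod_nonneg fun i _ => phi_nonneg _ _ (div_pos (hx i) hpos).le)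
  refine Finset.prod_congr rfl fun p _ => ?_
  unfold mm
  rw [div_mul_div_comm, Real.mul_self_sqrt (by positivity)]

lemma Cful_le {μ : ℝ} (hμ : 0 < μ) (k n : ℕ) (w : Fin n → ℝ) (hw : ∀ j, 0 ≤ w j) :
    (k.factorial : ℝ) * Cful μ k n w ≤
      ∑ t ∈ (Finset.univ : Finset (Fin k → Fin n)).filter Function.Injective,
        fDef μ n k (w ∘ t) := by
  classical
  unfold Cful
  have hterm : ∀ S ∈ Finset.powersetCard k (Finset.univ : Finset (Fin n)),
      ∀ t : Fin k → Fin n, Function.Injective t → Finset.univ.image t = S →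
      ∏ p ∈ Finset.univ.filter (fun p : Fin n × Fin n => p.1 ∈ S ∧ p.2 ∈ S ∧ p.1 < p.2),
      min (w p.1 * w p.2 / (μ * n)) 1 = fDef μ n k (w ∘ t) := by
    intro S hS t ht hSt
    have hA : 0 ≤ ∏ p ∈ Finset.univ.filter (fun p : Fin n × Fin n => p.1 ∈ S ∧ p.2 ∈ S ∧ p.1 < p.2),
      min (w p.1 * w p.2 / (μ * n)) 1 := Finset.prod_nonneg fun p _ => mm_nonneg hμ n (hw _) (hw _)
    have hB := fDef_nonneg hμ n k (x := w ∘ t) (fun i => hw _)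
    rw [← sq_eq_sq₀ hA hB, fDef_sq]
    have e1 : Finset.univ.filter (fun p : Fin n × Fin n => p.1 ∈ S ∧ p.2 ∈ S ∧ p.1 < p.2)
        = S.offDiag.filter (fun p => p.1 < p.2) := by
      ext ⟨a, b⟩; simp; grind
    rw [e1]
    have := prod_lt_sq S (fun i j => mm μ n (w i) (w j)) (fun i j => mm_comm _ _ _ _)
    unfold mm at this
    rw [this]
    symm
    refine Finset.prod_bij (fun p _ => (t p.1, t p.2)) ?_ ?_ ?_ ?_
    · rintro ⟨a, b⟩ h
      simp only [Finset.mem_offDiag] at h ⊢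
      rw [← hSt]
      exact ⟨Finset.mem_image_of_mem _ (Finset.mem_univ _), Finset.mem_image_of_mem _ (Finset.mem_univ _),
        fun e => h.2.2 (ht e)⟩
    · rintro ⟨a, b⟩ _ ⟨a', b'⟩ _ h
      simp only [Prod.mk.injEq] at h
      rw [ht h.1, ht h.2]
    · rintro ⟨a, b⟩ h
      rw [Finset.mem_offDiag, ← hSt] at h
      obtain ⟨h1, h2, h3⟩ := h
      obtain ⟨a', -, rfl⟩ := Finset.mem_image.1 h1
      obtain ⟨b', -, rfl⟩ := Finset.mem_image.1 h2
      refine ⟨(a', b'), ?_, rfl⟩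
      simp only [Finset.mem_offDiag, Finset.mem_univ, true_and]
      rintro rfl; exact h3 rfl
    · rintro ⟨a, b⟩ _; rfl
  rw [Finset.mul_sum, ← Finset.sum_fiberwise_of_maps_to (s := (Finset.univ : Finset (Fin k → Fin n)).filter Function.Injective)
    (t := Finset.powersetCard k (Finset.univ : Finset (Fin n))) (g := fun t => Finset.univ.image t)]
  · refine Finset.sum_le_sum fun S hS => ?_
    have hc : S.card = k := (Finset.mem_powersetCard.1 hS).2
    rw [Finset.sum_congr rfl (g := fun _ => ∏ p ∈ Finset.univ.filter (fun p : Fin n × Fin n => p.1 ∈ S ∧ p.2 ∈ S ∧ p.1 < p.2),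
      min (w p.1 * w p.2 / (μ * n)) 1)]
    · rw [Finset.sum_const, nsmul_eq_mul]
      refine mul_le_mul_of_nonneg_right ?_ (Finset.prod_nonneg fun p _ => mm_nonneg hμ n (hw _) (hw _))
      have : k.factorial = (Finset.univ : Finset (Equiv.Perm (Fin k))).card := by
        rw [Finset.card_univ, Fintype.card_perm, Fintype.card_fin]
      rw [this]
      norm_cast
      refine Finset.card_le_card_of_injOn (fun σ => S.orderEmbOfFin hc ∘ σ) ?_ ?_
      · intro σ _
        have hinj : Function.Injective (S.orderEmbOfFin hc ∘ σ) :=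
          (S.orderEmbOfFin hc).injective.comp σ.injective
        simp only [Finset.coe_filter, Finset.mem_filter, Finset.mem_univ, true_and, Set.mem_ofPred_eq]
        refine ⟨hinj, ?_⟩
        refine Finset.eq_of_subset_of_card_le ?_ ?_
        · intro x hx
          obtain ⟨y, -, rfl⟩ := Finset.mem_image.1 hx
          exact Finset.orderEmbOfFin_mem _ _ _
        · rw [Finset.card_image_of_injective _ hinj, hc]; simp
      · intro σ _ τ _ h
        ext x
        have := congrFun h x
        simp at this
        rw [this]
    · intro t ht
      simp only [Finset.mem_filter, Finset.mem_univ, true_and] at ht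
      exact (hterm S hS t ht.1 ht.2).symm
  · intro t ht
    simp only [Finset.mem_filter, Finset.mem_univ, true_and] at ht
    rw [Finset.mem_powersetCard]
    exact ⟨Finset.subset_univ _, by rw [Finset.card_image_of_injective _ ht]; simp⟩



/-- vertices of class `c` -/
def fib {n : ℕ} (cl : Fin n → Fin 4) (c : Fin 4) : Finset (Fin n) :=
  Finset.univ.filter (fun j => cl j = c)

lemma pattern_sum {k n : ℕ} (cl : Fin n → Fin 4) (χ : Fin k → Fin 4) (F : (Fin k → Fin n) → ℝ)
    (c A M : ℝ) (g : Fin n → ℝ) (hc : 0 ≤ c) (hg : ∀ j, 0 ≤ g j)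
    (hA : ∑ j ∈ fib cl 0, g j ≤ A) (hM : ∀ a, χ a ≠ 0 → ((fib cl (χ a)).card : ℝ) ≤ M)
    (q : ℕ) (hq : (Finset.univ.filter (fun a => χ a = 0)).card = q)
    (hF : ∀ t, Function.Injective t → (∀ a, cl (t a) = χ a) →
      F t ≤ c * ∏ a, if χ a = 0 then g (t a) else 1) :
    ∑ t ∈ ((Finset.univ : Finset (Fin k → Fin n)).filter Function.Injective).filter
      (fun t => cl ∘ t = χ), F t ≤ c * (A ^ q * M ^ (k - q)) := by
  classical
  have hnn : ∀ t : Fin k → Fin n, 0 ≤ c * ∏ a, if χ a = 0 then g (t a) else 1 := by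
    intro t
    refine mul_nonneg hc (Finset.prod_nonneg fun a _ => ?_)
    split_ifs
    · exact hg _
    · exact zero_le_one
  calc _ ≤ ∑ t ∈ ((Finset.univ : Finset (Fin k → Fin n)).filter Function.Injective).filter
          (fun t => cl ∘ t = χ), c * ∏ a, (if χ a = 0 then g (t a) else 1) := by
        refine Finset.sum_le_sum fun t ht => ?_
        simp only [Finset.mem_filter, Finset.mem_univ, true_and] at ht
        exact hF t ht.1 (fun a => congrFun ht.2 a)
    _ ≤ ∑ t ∈ Fintype.piFinset (fun a => fib cl (χ a)), c * ∏ a, (if χ a = 0 then g (t a) else 1) := by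
        refine Finset.sum_le_sum_of_subset_of_nonneg ?_ (fun t _ _ => hnn t)
        intro t ht
        simp only [Finset.mem_filter, Finset.mem_univ, true_and] at ht
        simp only [Fintype.mem_piFinset, fib, Finset.mem_filter, Finset.mem_univ, true_and]
        exact fun a => congrFun ht.2 a
    _ = c * ∏ a, ∑ j ∈ fib cl (χ a), (if χ a = 0 then g j else 1) := by
        rw [← Finset.mul_sum, Finset.prod_univ_sum]
    _ ≤ c * ∏ a, (if χ a = 0 then A else M) := by
        refine mul_le_mul_of_nonneg_left ?_ hc
        refine Finset.prod_le_prod (fun a _ => Finset.sum_nonneg fun j _ => ?_) (fun a _ => ?_)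
        · split_ifs
          · exact hg _
          · exact zero_le_one
        · split_ifs with h
          · rw [h]; exact hA
          · simpa using hM a h
    _ = _ := by
        congr 1
        rw [Finset.prod_ite, Finset.prod_const, Finset.prod_const, hq]
        congr 2
        have := Finset.card_filter_add_card_filter_not (s := (Finset.univ : Finset (Fin k))) (fun a => χ a = 0)
        simp only [Finset.card_univ, Fintype.card_fin] at this
        omega

lemma psi_eq {x y : ℝ} (hx : 0 < x) (hy : 0 < y) :
    x * min (x / y) 1 = y * phi 2 1 (x / y) := by
  unfold phi
  split_ifs with h
  · rw [min_eq_left h, Real.rpow_two]; field_simp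
  · rw [min_eq_right (not_le.1 h).le, Real.rpow_one]; field_simp

lemma psi_ge {u : ℝ} (_hu : 0 < u) : min u 1 * min u 1 ≤ phi 2 1 u := by
  unfold phi
  split_ifs with h
  · rw [min_eq_left h, Real.rpow_two]; exact (sq u).ge
  · rw [min_eq_right (not_le.1 h).le, Real.rpow_one]; linarith [not_le.1 h]

lemma mm_le_hub {μ : ℝ} (hμ : 0 < μ) {n : ℕ} (hn : 0 < n) {x z h : ℝ} (hx : 0 < x) (hz : 0 < z)
    (hzh : z ≤ h) : mm μ n x z ≤ min (x / (μ * n / h)) 1 := by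
  have hn' : (0 : ℝ) < n := by exact_mod_cast hn
  have : x / (μ * n / h) = x * h / (μ * n) := by
    have : 0 < h := hz.trans_le hzh
    field_simp
  rw [this]
  exact mm_mono hμ n hx.le hz.le le_rfl hzh

lemma det_bound {μ α ζ : ℝ} (hμ : 0 < μ) (h1 : 1 < α) (h2 : α < 2) (hζ : ζ = (2 - α) / 7)
    {k n : ℕ} (hn : 0 < n) (w : Fin n → ℝ) (hw : ∀ j, 0 < w j)
    (cl : Fin n → Fin 4) (i : ℕ) (hi : i + 3 ≤ k) (hub : (fib cl 3).card ≤ i)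
    (M N c0 h A0 A1 A2 A3 B : ℝ)
    (hM : ∀ c, c ≠ 0 → ((fib cl c).card : ℝ) ≤ M)
    (hN2 : ((fib cl 2).card : ℝ) ≤ N) (hN3 : ((fib cl 3).card : ℝ) ≤ N)
    (hc0 : 0 < c0) (hh : 0 < h)
    (hmid : ∀ j, cl j = 1 → w j ≤ c0) (hhigh : ∀ j, cl j = 1 ∨ cl j = 2 → w j ≤ h)
    (s0 : ∑ t ∈ Fintype.piFinset (fun _ : Fin k => fib cl 0), fDef μ n k (w ∘ t) ≤ A0)
    (s1 : ∑ j ∈ fib cl 0, phi (α + ζ) (α - ζ) (w j / √(μ * n)) ≤ A1)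
    (s2 : ∑ j ∈ fib cl 0, phi 2 1 (w j / (μ * n / c0)) ≤ A2)
    (s3 : ∑ j ∈ fib cl 0, phi 2 1 (w j / (μ * n / h)) ≤ A3)
    (b1 : ∀ q, 3 ≤ q → q < k → A1 ^ q * M ^ (k - q) ≤ B)
    (b2 : (μ * n / c0) ^ 2 / (μ * n) * (A2 ^ 2 * M ^ (k - 2)) ≤ B)
    (b3 : (μ * n / h) ^ 2 / (μ * n) * (A3 ^ 2 * N ^ (k - 2)) ≤ B)
    (b4 : A3 ^ 1 * M ^ (k - 1) ≤ B) (b5 : M ^ k ≤ B) :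
    ∑ t ∈ (Finset.univ : Finset (Fin k → Fin n)).filter Function.Injective,
        fDef μ n k (w ∘ t) ≤ A0 + 4 ^ k * B := by
  classical
  have hn' : (0 : ℝ) < n := by exact_mod_cast hn
  have hsq : 0 < √(μ * n) := by positivity
  have hM0 : 0 ≤ M := (Nat.cast_nonneg _).trans (hM 1 (by decide))
  have hB0 : 0 ≤ B := (pow_nonneg hM0 k).trans b5
  have hA0 : 0 ≤ A0 := le_trans (Finset.sum_nonneg fun t _ => fDef_nonneg hμ n k fun a => (hw _).le) s0
  have hpat : ∀ χ : Fin k → Fin 4,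
      ∑ t ∈ ((Finset.univ : Finset (Fin k → Fin n)).filter Function.Injective).filter
      (fun t => cl ∘ t = χ), fDef μ n k (w ∘ t) ≤ (if χ = fun _ => 0 then A0 else 0) + B := by
    intro χ
    by_cases hχ : χ = fun _ => 0
    · rw [if_pos hχ]
      refine le_trans (le_trans ?_ s0) (by linarith)
      refine Finset.sum_le_sum_of_subset_of_nonneg ?_ (fun t _ _ => fDef_nonneg hμ n k fun a => (hw _).le)
      intro t ht
      simp only [Finset.mem_filter, Finset.mem_univ, true_and] at ht
      simp only [Fintype.mem_piFinset, fib, Finset.mem_filter, Finset.mem_univ, true_and]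
      intro a
      have := congrFun ht.2 a
      rw [hχ] at this
      exact this
    rw [if_neg hχ, zero_add]
    -- number of hub coordinates
    by_cases hb : i < (Finset.univ.filter (fun a => χ a = 3)).card
    · rw [Finset.sum_eq_zero]
      · exact hB0
      · intro t ht
        exfalso
        simp only [Finset.mem_filter, Finset.mem_univ, true_and] at ht
        have : (Finset.univ.filter (fun a => χ a = 3)).card ≤ (fib cl 3).card := by
          refine Finset.card_le_card_of_injOn t ?_ ht.1.injOn
          intro a ha
          simp only [Finset.coe_filter, Finset.mem_univ, true_and, Set.mem_ofPred_eq] at ha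
          simp only [fib, Finset.coe_filter, Finset.mem_univ, true_and, Set.mem_ofPred_eq]
          rw [← ha]; exact congrFun ht.2 a
        omega
    push Not at hb
    set P := Finset.univ.filter (fun a => χ a = 0) with hP
    set R := Finset.univ.filter (fun a => χ a = 1 ∨ χ a = 2) with hR
    have hcount : k ≤ P.card + R.card + i := by
      have : (Finset.univ : Finset (Fin k)) ⊆ P ∪ R ∪ Finset.univ.filter (fun a => χ a = 3) := by
        intro a _
        simp only [hP, hR, Finset.mem_union, Finset.mem_filter, Finset.mem_univ, true_and]
        generalize χ a = z
        revert z; decide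
      have h4 := Finset.card_le_card this
      have h5 := Finset.card_union_le (P ∪ R) (Finset.univ.filter (fun a => χ a = 3))
      have h6 := Finset.card_union_le P R
      simp only [Finset.card_univ, Fintype.card_fin] at h4
      omega
    have hPk : P.card < k := by
      by_contra hcon
      apply hχ
      have : P = Finset.univ := by
        refine Finset.eq_univ_of_card _ ?_
        have := Finset.card_le_univ P
        simp only [Fintype.card_fin] at this ⊢
        omega
      funext a
      have ha : a ∈ P := by rw [this]; exact Finset.mem_univ _
      exact (Finset.mem_filter.1 ha).2
    have hprod : ∀ (g : Fin n → ℝ) (t : Fin k → Fin n),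
        (∏ a, if χ a = 0 then g (t a) else 1) = ∏ a ∈ P, g (t a) := by
      intro g t
      rw [hP, Finset.prod_filter]
    have hyy : ∀ z, 0 < z → 0 < μ * n / z := fun z hz => by positivity
    -- bound with two low vertices
    have htwo : ∀ z, 0 < z → P.card = 2 → (∃ a, χ a ≠ 0 ∧ ∀ j, cl j = χ a → w j ≤ z) →
        ∀ t, Function.Injective t → (∀ a, cl (t a) = χ a) →
        fDef μ n k (w ∘ t) ≤ (μ * n / z) ^ 2 / (μ * n) *
          ∏ a, if χ a = 0 then phi 2 1 (w (t a) / (μ * n / z)) else 1 := by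
      intro z hz hc2 ⟨l, hl0, hl⟩ t ht htc
      rw [hprod (fun j => phi 2 1 (w j / (μ * n / z)))]
      obtain ⟨a, b, hab, hPab⟩ := Finset.card_eq_two.1 hc2
      have haP : χ a = 0 := by
        have : a ∈ P := by rw [hPab]; simp
        exact (Finset.mem_filter.1 this).2
      have hbP : χ b = 0 := by
        have : b ∈ P := by rw [hPab]; simp
        exact (Finset.mem_filter.1 this).2
      have hal : a ≠ l := by rintro rfl; exact hl0 haP
      have hbl : b ≠ l := by rintro rfl; exact hl0 hbP
      have hz' : w (t l) ≤ z := hl _ (htc l)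
      have e1 := fDef_tri hμ n k (x := w ∘ t) (fun a => (hw _).le) hab hal hbl
      have e2 := mm_le_hub hμ hn (hw (t a)) (hw (t l)) hz'
      have e3 := mm_le_hub hμ hn (hw (t b)) (hw (t l)) hz'
      have e4 : mm μ n (w (t a)) (w (t b)) ≤ w (t a) * w (t b) / (μ * n) := min_le_left _ _
      have n1 := mm_nonneg hμ n (hw (t a)).le (hw (t b)).le
      have n2 := mm_nonneg hμ n (hw (t a)).le (hw (t l)).le
      have n3 := mm_nonneg hμ n (hw (t b)).le (hw (t l)).le
      rw [hPab, Finset.prod_pair hab]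
      have p1 := psi_eq (hw (t a)) (hyy z hz)
      have p2 := psi_eq (hw (t b)) (hyy z hz)
      calc fDef μ n k (w ∘ t) ≤ _ := e1
        _ ≤ w (t a) * w (t b) / (μ * n) * min (w (t a) / (μ * n / z)) 1 * min (w (t b) / (μ * n / z)) 1 := by
            simp only [Function.comp]
            have := hw (t a)
            have := hw (t b)
            gcongr
        _ = (w (t a) * min (w (t a) / (μ * n / z)) 1) * (w (t b) * min (w (t b) / (μ * n / z)) 1) / (μ * n) := by ring
        _ = _ := by rw [p1, p2]; ring
    have hpos : ∀ z, 0 < z → ∀ j, 0 ≤ phi 2 1 (w j / (μ * n / z)) := fun z hz j =>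
      phi_nonneg _ _ (div_pos (hw j) (hyy z hz)).le
    rcases Nat.lt_or_ge P.card 3 with hq | hq
    · obtain hq | hq | hq : P.card = 0 ∨ P.card = 1 ∨ P.card = 2 := by omega
      · refine le_trans (pattern_sum cl χ _ 1 0 M (fun _ => 0) zero_le_one (fun _ => le_rfl) (by simp)
          (fun a ha => hM _ ha) 0 hq ?_) (by simpa using b5)
        intro t _ _
        rw [hprod (fun _ => 0) t, Finset.card_eq_zero.1 hq]
        simpa using fDef_le_one hμ n k (x := w ∘ t) fun a => (hw _).le
      · have hR2 : 1 < R.card := by omega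
        obtain ⟨l, hl, l', hl', hll⟩ := Finset.one_lt_card.1 hR2
        refine le_trans (pattern_sum cl χ _ 1 A3 M (fun j => phi 2 1 (w j / (μ * n / h))) zero_le_one
          (hpos h hh) s3 (fun a ha => hM _ ha) 1 hq ?_) (by simpa using b4)
        intro t ht htc
        rw [hprod (fun j => phi 2 1 (w j / (μ * n / h)))]
        obtain ⟨a, hPa⟩ := Finset.card_eq_one.1 hq
        have haP : χ a = 0 := by
          have : a ∈ P := by rw [hPa]; simp
          exact (Finset.mem_filter.1 this).2
        replace hl := (Finset.mem_filter.1 hl).2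
        replace hl' := (Finset.mem_filter.1 hl').2
        have hal : a ≠ l := by rintro rfl; rw [haP] at hl; revert hl; decide
        have hal' : a ≠ l' := by rintro rfl; rw [haP] at hl'; revert hl'; decide
        have e1 := fDef_tri hμ n k (x := w ∘ t) (fun a => (hw _).le) hal hal' hll
        have e2 := mm_le_hub hμ hn (hw (t a)) (hw (t l)) (hhigh (t l) (by rw [htc]; exact hl))
        have e3 := mm_le_hub hμ hn (hw (t a)) (hw (t l')) (hhigh (t l') (by rw [htc]; exact hl'))
        have n2 := mm_nonneg hμ n (hw (t a)).le (hw (t l)).le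
        have n3 := mm_nonneg hμ n (hw (t a)).le (hw (t l')).le
        rw [hPa, Finset.prod_singleton, one_mul]
        calc fDef μ n k (w ∘ t) ≤ _ := e1
          _ ≤ mm μ n (w (t a)) (w (t l)) * mm μ n (w (t a)) (w (t l')) :=
              mul_le_of_le_one_right (mul_nonneg n2 n3) (mm_le_one _ _ _ _)
          _ ≤ _ := mul_le_mul e2 e3 n3 (n2.trans e2)
          _ ≤ _ := psi_ge (div_pos (hw _) (hyy h hh))
      · by_cases hmidc : ∃ a, χ a = 1
        · obtain ⟨l, hl⟩ := hmidc
          refine le_trans (pattern_sum cl χ _ _ A2 M (fun j => phi 2 1 (w j / (μ * n / c0))) (by positivity)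
            (hpos c0 hc0) s2 (fun a ha => hM _ ha) 2 hq ?_) b2
          exact htwo c0 hc0 hq ⟨l, by rw [hl]; decide, fun j hj => hmid j (by rw [hj, hl])⟩
        · push Not at hmidc
          have hR1 : 0 < R.card := by omega
          obtain ⟨l, hl⟩ := Finset.card_pos.1 hR1
          replace hl := (Finset.mem_filter.1 hl).2
          refine le_trans (pattern_sum cl χ _ _ A3 N (fun j => phi 2 1 (w j / (μ * n / h))) (by positivity)
            (hpos h hh) s3 (fun a ha => ?_) 2 hq ?_) b3
          · have h3 : χ a = 2 ∨ χ a = 3 := by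
              have := hmidc a
              generalize χ a = z at *
              revert z; decide
            rcases h3 with h3 | h3
            · rw [h3]; exact hN2
            · rw [h3]; exact hN3
          · exact htwo h hh hq ⟨l, by rcases hl with hl | hl <;> (rw [hl]; decide),
              fun j hj => hhigh j (by rw [hj]; exact hl)⟩
    · refine le_trans (pattern_sum cl χ _ 1 A1 M (fun j => phi (α + ζ) (α - ζ) (w j / √(μ * n))) zero_le_one
          (fun j => phi_nonneg _ _ (div_pos (hw j) hsq).le) s1 (fun a ha => hM _ ha) P.card rfl ?_)
          (by simpa using b1 P.card hq hPk)
      intro t _ _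
      rw [hprod (fun j => phi (α + ζ) (α - ζ) (w j / √(μ * n))), one_mul]
      exact fDef_le_phi hμ hn (fun a => hw _) P hq h1 h2 hζ
  rw [← Finset.sum_fiberwise (s := (Finset.univ : Finset (Fin k → Fin n)).filter Function.Injective)
    (g := fun t => cl ∘ t)]
  refine (Finset.sum_le_sum fun χ _ => hpat χ).trans ?_
  rw [Finset.sum_add_distrib, Finset.sum_ite_eq']
  simp



lemma lint_succ (ν : Measure ℝ) [IsProbabilityMeasure ν] (k : ℕ) (F : (Fin (k+1) → ℝ) → ENNReal)
    (hF : Measurable F) :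
    ∫⁻ x, F x ∂(Measure.pi fun _ : Fin (k+1) => ν) =
      ∫⁻ y, ∫⁻ x, F (Fin.cons x y) ∂ν ∂(Measure.pi fun _ : Fin k => ν) := by
  have h := (measurePreserving_piFinSuccAbove (fun _ : Fin (k+1) => ν) 0).symm
  rw [← h.lintegral_comp hF]
  refine (lintegral_prod_symm' (μ := ν) (ν := Measure.pi fun _ : Fin k => ν) _
    (hF.comp h.measurable)).trans ?_
  refine lintegral_congr fun y => lintegral_congr fun x => ?_
  change F _ = F _
  refine congrArg F ?_
  funext a
  refine Fin.cases ?_ (fun b => ?_) a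
  · rfl
  · rfl

lemma lint_prod (ν : Measure ℝ) [IsProbabilityMeasure ν] (k : ℕ) (g : ℝ → ENNReal)
    (hg : Measurable g) :
    ∫⁻ x, ∏ i, g (x i) ∂(Measure.pi fun _ : Fin k => ν) = (∫⁻ x, g x ∂ν) ^ k := by
  induction k with
  | zero => simp
  | succ k ih =>
    rw [lint_succ _ _ _ (by fun_prop)]
    simp only [Fin.prod_univ_succ, Fin.cons_zero, Fin.cons_succ]
    have : ∀ y : Fin k → ℝ, ∫⁻ x, g x * ∏ i, g (y i) ∂ν = (∫⁻ x, g x ∂ν) * ∏ i, g (y i) := by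
      intro y; rw [lintegral_mul_const _ hg]
    simp only [this]
    rw [lintegral_const_mul _ (by fun_prop), ih, pow_succ, mul_comm]

open Classical in
lemma chernoff (ν : Measure ℝ) [IsProbabilityMeasure ν] (n : ℕ) (U : Set ℝ) (hU : MeasurableSet U)
    (s : ℝ) (hs : 1 ≤ s) (m : ℕ) :
    (Measure.pi fun _ : Fin n => ν) {w | m ≤ (Finset.univ.filter (fun j => w j ∈ U)).card} ≤
      ENNReal.ofReal (Real.exp (n * (ν U).toReal * (s - 1)) / s ^ m) := by
  have hs0 : 0 < s := by linarith
  set g : ℝ → ENNReal := fun x => if x ∈ U then ENNReal.ofReal s else 1 with hg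
  have hgm : Measurable g := Measurable.ite hU measurable_const measurable_const
  have hprod : ∀ w : Fin n → ℝ, ∏ i, g (w i) =
      ENNReal.ofReal s ^ (Finset.univ.filter (fun j => w j ∈ U)).card := by
    intro w
    simp only [hg]
    rw [Finset.prod_ite]
    simp
  have h1 := meas_ge_le_lintegral_div (μ := Measure.pi fun _ : Fin n => ν)
    (f := fun w => ∏ i, g (w i)) (Finset.measurable_prod _ fun i _ =>
      hgm.comp (measurable_pi_apply i)).aemeasurable (ε := ENNReal.ofReal s ^ m) (by simp [hs0])
    (by simp)
  rw [lint_prod _ _ _ hgm] at h1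
  refine le_trans (measure_mono ?_) (h1.trans ?_)
  · intro w hw
    simp only [Set.mem_ofPred_eq] at hw ⊢
    rw [hprod]
    exact pow_le_pow_right₀ (by simpa using hs) hw
  · have hint : ∫⁻ x, g x ∂ν ≤ ENNReal.ofReal (1 + (ν U).toReal * (s-1)) := by
      have : ∀ x, g x = 1 + U.indicator (fun _ => ENNReal.ofReal (s-1)) x := by
        intro x
        simp only [hg, Set.indicator]
        split_ifs
        · rw [← ENNReal.ofReal_one, ← ENNReal.ofReal_add] <;> first | linarith | congr 1; ring
        · simp
      simp only [this]
      rw [lintegral_add_left measurable_const, lintegral_indicator_const hU]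
      rw [ENNReal.ofReal_add zero_le_one (by positivity [sub_nonneg.2 hs]), mul_comm (ν U).toReal,
        ENNReal.ofReal_mul (sub_nonneg.2 hs), ENNReal.ofReal_toReal (measure_ne_top _ _)]
      simp
    rw [ENNReal.ofReal_div_of_pos (by positivity), ENNReal.ofReal_pow hs0.le]
    refine ENNReal.div_le_div_right ?_ _
    refine (pow_le_pow_left' hint n).trans ?_
    have hp : 0 ≤ (ν U).toReal * (s-1) := mul_nonneg ENNReal.toReal_nonneg (by linarith)
    rw [← ENNReal.ofReal_pow (by linarith)]
    apply ENNReal.ofReal_le_ofReal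
    rw [mul_assoc, Real.exp_nat_mul]
    refine pow_le_pow_left₀ (by linarith) ?_ n
    linarith [Real.add_one_le_exp ((ν U).toReal * (s-1))]

lemma quantile (ν : Measure ℝ) [IsProbabilityMeasure ν] (t : ENNReal) :
    ∃ U : Set ℝ, MeasurableSet U ∧ ν U ≤ t ∧ ∀ z, ν (Ici z) < t → Ici z ⊆ U := by
  set Z : Set ℝ := {z | ν (Ici z) < t} with hZ
  refine ⟨⋃ z ∈ Z, Ici z, ?_, ?_, fun z hz => ?_⟩
  · have : IsUpperSet (⋃ z ∈ Z, Ici z) := isUpperSet_iUnion₂ fun z _ => isUpperSet_Ici z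
    exact this.ordConnected.measurableSet
  · rcases Z.eq_empty_or_nonempty with h | h
    · simp [h]
    by_cases hb : BddBelow Z
    · obtain ⟨u, hu1, -, hu2, hu3⟩ := (isGLB_csInf h hb).exists_seq_antitone_tendsto h
      by_cases hs : sInf Z ∈ Z
      · refine le_trans (measure_mono ?_) (le_of_lt hs)
        exact iUnion₂_subset fun z hz => Ici_subset_Ici.2 (csInf_le hb hz)
      · have : (⋃ z ∈ Z, Ici z) ⊆ ⋃ j, Ici (u j) := by
          refine iUnion₂_subset fun z hz => ?_
          have : sInf Z < z := lt_of_le_of_ne (csInf_le hb hz) (fun h => hs (h ▸ hz))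
          obtain ⟨j, hj⟩ := (hu2.eventually_lt_const this).exists
          exact (Ici_subset_Ici.2 hj.le).trans (subset_iUnion (fun j => Ici (u j)) j)
        refine (measure_mono this).trans ?_
        rw [Monotone.measure_iUnion (fun a b hab => Ici_subset_Ici.2 (hu1 hab))]
        exact iSup_le fun j => le_of_lt (hu3 j)
    · have : (⋃ z ∈ Z, Ici z) ⊆ ⋃ j : ℕ, Ici (-(j:ℝ)) := by
        intro x _
        obtain ⟨j, hj⟩ := exists_nat_ge (-x)
        exact mem_iUnion.2 ⟨j, by simp only [mem_Ici]; linarith⟩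
      refine (measure_mono this).trans ?_
      rw [Monotone.measure_iUnion (fun a b hab => Ici_subset_Ici.2 (by
        have : (a:ℝ) ≤ b := by exact_mod_cast hab
        linarith))]
      refine iSup_le fun j => ?_
      rw [not_bddBelow_iff] at hb
      obtain ⟨y, hy, hyj⟩ := hb (-(j:ℝ))
      exact (measure_mono (Ici_subset_Ici.2 hyj.le)).trans (le_of_lt hy)
  · exact subset_biUnion_of_mem (u := fun z => Ici z) hz

lemma dom1 {ι : Type*} (ν : Measure ℝ) (Low : Finset ι) (w : ι → ℝ) (K : ENNReal)
    (h : ∀ z, ((Low.filter (fun j => z ≤ w j)).card : ENNReal) ≤ K * ν (Ici z))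
    (g : ℝ → ENNReal) (hg : Monotone g) (hf : ∀ x, g x ≠ ⊤) :
    ∑ j ∈ Low, g (w j) ≤ K * ∫⁻ x, g x ∂ν := by
  classical
  set e : Measure ℝ := ∑ j ∈ Low, Measure.dirac (w j) with he
  have h1 : ∑ j ∈ Low, g (w j) = ∫⁻ x, g x ∂e := by
    rw [he, lintegral_finsetSum_measure]
    simp
  have hup : ∀ S : Set ℝ, IsUpperSet S → e S ≤ K * ν S := by
    intro S hS
    have hSm := hS.ordConnected.measurableSet
    have heS : e S = ((Low.filter (fun j => w j ∈ S)).card : ENNReal) := by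
      rw [he, Measure.finsetSum_apply]
      simp [Measure.dirac_apply' _ hSm, Set.indicator]
    rw [heS]
    rcases (Low.filter (fun j => w j ∈ S)).eq_empty_or_nonempty with h0 | h0
    · simp [h0]
    · obtain ⟨p, hp, hmin⟩ := Finset.exists_min_image _ w h0
      have hpS := (Finset.mem_filter.1 hp).2
      refine le_trans ?_ ((h (w p)).trans (mul_le_mul_right (measure_mono ?_) _))
      · exact_mod_cast Finset.card_le_card fun j hj =>
          Finset.mem_filter.2 ⟨(Finset.mem_filter.1 hj).1, hmin j hj⟩
      · intro x hx
        exact hS hx hpS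
  have hgr : ∀ x, g x = ENNReal.ofReal (g x).toReal := fun x => (ENNReal.ofReal_toReal (hf x)).symm
  have hmono : Monotone fun x => (g x).toReal := fun a b hab => ENNReal.toReal_mono (hf b) (hg hab)
  rw [h1]
  rw [lintegral_congr (μ := e) hgr, lintegral_congr (μ := ν) hgr]
  rw [lintegral_eq_lintegral_meas_lt e (ae_of_all _ fun x => ENNReal.toReal_nonneg)
      hmono.measurable.aemeasurable,
    lintegral_eq_lintegral_meas_lt ν (ae_of_all _ fun x => ENNReal.toReal_nonneg)
      hmono.measurable.aemeasurable]
  have hup' : ∀ t, e {a | t < (g a).toReal} ≤ K * ν {a | t < (g a).toReal} := fun t => by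
    refine hup _ ?_
    intro a b hab ha
    exact lt_of_lt_of_le ha (hmono hab)
  refine (lintegral_mono hup').trans ?_
  rw [lintegral_const_mul]
  have : Antitone fun t => ν {a | t < (g a).toReal} := by
    intro s t hst
    exact measure_mono fun a ha => lt_of_le_of_lt hst ha
  exact this.measurable

lemma domk {n : ℕ} (ν : Measure ℝ) [IsProbabilityMeasure ν] (Low : Finset (Fin n)) (w : Fin n → ℝ)
    (K : ENNReal)
    (h : ∀ z, ((Low.filter (fun j => z ≤ w j)).card : ENNReal) ≤ K * ν (Ici z)) (k : ℕ)
    (F : (Fin k → ℝ) → ENNReal) (hF : Monotone F) (hm : Measurable F) (hf : ∀ x, F x ≠ ⊤) :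
    ∑ t ∈ Fintype.piFinset (fun _ : Fin k => Low), F (w ∘ t) ≤
      K ^ k * ∫⁻ x, F x ∂(Measure.pi fun _ : Fin k => ν) := by
  induction k with
  | zero =>
    have : ∀ x : Fin 0 → ℝ, F x = F (fun a => a.elim0) := fun x => congrArg F (Subsingleton.elim _ _)
    rw [lintegral_congr this]
    simp [this]
  | succ k ih =>
    rw [lint_succ _ _ _ hm]
    have hcons : ∀ x, Monotone fun y : Fin k → ℝ => F (Fin.cons x y : Fin (k+1) → ℝ) := by
      intro x y y' hy
      exact hF (Fin.cons_le_cons.2 ⟨le_rfl, hy⟩)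
    have hcons' : ∀ y : Fin k → ℝ, Monotone fun x => F (Fin.cons x y : Fin (k+1) → ℝ) := by
      intro y x x' hx
      exact hF (Fin.cons_le_cons.2 ⟨hx, le_rfl⟩)
    have hmeas : ∀ x, Measurable fun y : Fin k → ℝ => F (Fin.cons x y : Fin (k+1) → ℝ) := by
      intro x
      refine hm.comp (measurable_pi_iff.2 fun a => ?_)
      refine Fin.cases ?_ (fun b => ?_) a
      · simp
      · simpa using measurable_pi_apply b
    have e1 : ∑ t ∈ Fintype.piFinset (fun _ : Fin (k+1) => Low), F (w ∘ t) =
        ∑ j ∈ Low, ∑ t ∈ Fintype.piFinset (fun _ : Fin k => Low),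
          F (Fin.cons (w j) (w ∘ t) : Fin (k+1) → ℝ) := by
      rw [← Finset.sum_product']
      refine Finset.sum_bij' (fun t _ => (t 0, Fin.tail t)) (fun p _ => Fin.cons p.1 p.2)
        ?_ ?_ ?_ ?_ ?_
      · intro t ht
        simp only [Fintype.mem_piFinset, Finset.mem_product] at ht ⊢
        exact ⟨ht 0, fun a => ht a.succ⟩
      · intro p hp
        simp only [Fintype.mem_piFinset, Finset.mem_product] at hp ⊢
        intro a
        refine Fin.cases ?_ (fun b => ?_) a
        · exact hp.1
        · exact hp.2 b
      · intro t ht; simp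
      · intro p hp; simp
      · intro t ht
        congr 1
        funext a
        refine Fin.cases ?_ (fun b => ?_) a
        · rfl
        · rfl
    rw [e1]
    calc _ ≤ ∑ j ∈ Low, K ^ k * ∫⁻ y, F (Fin.cons (w j) y : Fin (k+1) → ℝ) ∂(Measure.pi fun _ : Fin k => ν) :=
          Finset.sum_le_sum fun j _ => ih _ (hcons _) (hmeas _) (fun x => hf _)
      _ = K ^ k * ∫⁻ y, ∑ j ∈ Low, F (Fin.cons (w j) y : Fin (k+1) → ℝ) ∂(Measure.pi fun _ : Fin k => ν) := by
          rw [lintegral_finsetSum _ (fun j _ => hmeas _), Finset.mul_sum]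
      _ ≤ K ^ k * ∫⁻ y, K * ∫⁻ x, F (Fin.cons x y : Fin (k+1) → ℝ) ∂ν ∂(Measure.pi fun _ : Fin k => ν) := by
          gcongr with y
          exact dom1 ν Low w K h _ (hcons' y) (fun x => hf _)
      _ ≤ _ := by
          rw [pow_succ, mul_assoc]
          gcongr
          rw [lintegral_const_mul]
          have : Measurable fun p : (Fin k → ℝ) × ℝ => F (Fin.cons p.2 p.1 : Fin (k+1) → ℝ) := by
            refine hm.comp (measurable_pi_iff.2 fun a => ?_)
            refine Fin.cases ?_ (fun b => ?_) a
            · simpa using measurable_snd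
            · exact (measurable_pi_apply b).comp measurable_fst
          exact this.lintegral_prod_right'



lemma bad_prob (ν : Measure ℝ) [IsProbabilityMeasure ν] (δ : ℝ) (hδ : 0 < δ) (n : ℕ) (hn : 0 < n)
    (z0 : ℝ) (m0 : ℕ) (hm0 : (m0 : ℝ) ≤ (1 + δ) * n * (ν (Ici z0)).toReal) :
    (Measure.pi fun _ : Fin n => ν) {w | ∃ z ≤ z0, (1 + δ) * n * (ν (Ici z)).toReal <
        ((Finset.univ.filter (fun j => z ≤ w j)).card : ℝ)} ≤
      ENNReal.ofReal ((n + 1) * (Real.exp (δ / (1 + δ)) / (1 + δ)) ^ m0) := by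
  classical
  have hn' : (0 : ℝ) < n := by exact_mod_cast hn
  set ρ := Real.exp (δ / (1 + δ)) / (1 + δ) with hρ
  have hρ0 : 0 ≤ ρ := by positivity
  have hρ1 : ρ ≤ 1 := by
    rw [hρ, div_le_one (by positivity)]
    have h1 := Real.add_one_le_exp (-(δ / (1+δ)))
    rw [Real.exp_neg] at h1
    have h2 : -(δ / (1+δ)) + 1 = (1+δ)⁻¹ := by field_simp; ring
    rw [h2] at h1
    exact (inv_le_inv₀ (by positivity) (by positivity)).1 h1
  choose U hUm hUt hUz using fun m : ℕ => quantile ν (ENNReal.ofReal (m / ((1 + δ) * n)))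
  have hsub : {w : Fin n → ℝ | ∃ z ≤ z0, (1 + δ) * n * (ν (Ici z)).toReal <
        ((Finset.univ.filter (fun j => z ≤ w j)).card : ℝ)} ⊆
      ⋃ m ∈ Finset.Icc m0 n, {w | m ≤ (Finset.univ.filter (fun j => w j ∈ U m)).card} := by
    rintro w ⟨z, hz, hw⟩
    set m := (Finset.univ.filter (fun j => z ≤ w j)).card with hm
    have hmn : m ≤ n := by
      have := Finset.card_le_univ (Finset.univ.filter (fun j => z ≤ w j))
      simpa using this
    have hmono : (ν (Ici z0)).toReal ≤ (ν (Ici z)).toReal :=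
      ENNReal.toReal_mono (measure_ne_top _ _) (measure_mono (Ici_subset_Ici.2 hz))
    have hm0m : m0 ≤ m := by
      have : (m0 : ℝ) ≤ m := by
        refine hm0.trans (le_trans ?_ hw.le)
        gcongr
      exact_mod_cast this
    simp only [mem_iUnion]
    refine ⟨m, Finset.mem_Icc.2 ⟨hm0m, hmn⟩, ?_⟩
    have hlt : ν (Ici z) < ENNReal.ofReal (m / ((1 + δ) * n)) := by
      rw [ENNReal.lt_ofReal_iff_toReal_lt (measure_ne_top _ _), lt_div_iff₀ (by positivity)]
      linarith
    have hs := hUz m z hlt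
    refine Finset.card_le_card fun j hj => ?_
    simp only [Finset.mem_filter, Finset.mem_univ, true_and] at hj ⊢
    exact hs hj
  refine (measure_mono hsub).trans ((measure_biUnion_finset_le _ _).trans ?_)
  calc _ ≤ ∑ m ∈ Finset.Icc m0 n, ENNReal.ofReal (ρ ^ m0) := by
        refine Finset.sum_le_sum fun m hm => ?_
        refine (chernoff ν n (U m) (hUm m) (1 + δ) (by linarith) m).trans ?_
        apply ENNReal.ofReal_le_ofReal
        have h1 : (ν (U m)).toReal ≤ m / ((1 + δ) * n) :=
          ENNReal.toReal_le_of_le_ofReal (by positivity) (hUt m)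
        have h2 : n * (ν (U m)).toReal * (1 + δ - 1) ≤ m * (δ / (1 + δ)) := by
          calc n * (ν (U m)).toReal * (1 + δ - 1) ≤ n * (m / ((1 + δ) * n)) * (1 + δ - 1) := by
                have : 0 ≤ 1 + δ - 1 := by linarith
                gcongr
            _ = _ := by field_simp; ring
        calc _ ≤ Real.exp (m * (δ / (1 + δ))) / (1 + δ) ^ m := by gcongr
          _ = ρ ^ m := by rw [hρ, div_pow, Real.exp_nat_mul]
          _ ≤ ρ ^ m0 := pow_le_pow_of_le_one hρ0 hρ1 (Finset.mem_Icc.1 hm).1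
    _ ≤ _ := by
        rw [Finset.sum_const, nsmul_eq_mul, ENNReal.ofReal_mul (by positivity)]
        gcongr
        rw [← Nat.cast_succ, ENNReal.ofReal_natCast]
        have : (Finset.Icc m0 n).card ≤ n + 1 := by simp
        exact_mod_cast this

lemma rho_lt_one (δ : ℝ) (hδ : 0 < δ) : Real.exp (δ / (1 + δ)) / (1 + δ) < 1 := by
  rw [div_lt_one (by positivity)]
  have h1 := Real.add_one_lt_exp (x := -(δ / (1+δ))) (by
    have : 0 < δ / (1 + δ) := by positivity
    linarith)
  rw [Real.exp_neg] at h1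
  have h2 : -(δ / (1+δ)) + 1 = (1+δ)⁻¹ := by field_simp; ring
  rw [h2] at h1
  exact (inv_lt_inv₀ (by positivity) (by positivity)).1 h1

lemma many_prob (ν : Measure ℝ) [IsProbabilityMeasure ν] (n : ℕ) (c l : ℝ) (hl0 : 0 < l) (hl1 : l ≤ 1)
    (hl : n * (ν (Ioi c)).toReal ≤ l) (N : ℕ) :
    (Measure.pi fun _ : Fin n => ν) {w | N ≤ (Finset.univ.filter (fun j => c < w j)).card} ≤
      ENNReal.ofReal (Real.exp 1 * l ^ N) := by
  classical
  have h := chernoff ν n (Ioi c) measurableSet_Ioi (1 / l) (by rw [le_div_iff₀ hl0]; linarith) N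
  refine le_trans (le_of_eq ?_) (h.trans (ENNReal.ofReal_le_ofReal ?_))
  · congr 1
  · rw [one_div, inv_pow, div_inv_eq_mul]
    gcongr
    have : 0 ≤ l⁻¹ - 1 := by
      rw [sub_nonneg]; exact (one_le_inv₀ hl0).2 hl1
    calc n * (ν (Ioi c)).toReal * (l⁻¹ - 1) ≤ l * (l⁻¹ - 1) := by gcongr
      _ = 1 - l := by field_simp
      _ ≤ 1 := by linarith

/-- tail bounds -/
lemma tail_upper (α : ℝ) (hα : 0 < α) (ν : Measure ℝ) [IsProbabilityMeasure ν]
    (htail : Tendsto (fun x : ℝ => x ^ α * (ν (Set.Ioi x)).toReal) atTop (nhds 1)) :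
    ∃ C0, 0 < C0 ∧ ∀ x, 0 < x → (ν (Ioi x)).toReal ≤ C0 * x ^ (-α) := by
  obtain ⟨x0, hx0⟩ := eventually_atTop.1 (htail.eventually_lt_const (show (1:ℝ) < 2 by norm_num))
  set y := max x0 1 with hy
  have hy1 : 1 ≤ y := le_max_right _ _
  have hprob : ∀ x, (ν (Ioi x)).toReal ≤ 1 := fun x =>
    ENNReal.toReal_le_of_le_ofReal zero_le_one (by simpa using prob_le_one)
  refine ⟨2 + y ^ α, by positivity, fun x hx => ?_⟩
  rw [Real.rpow_neg hx.le, ← div_eq_mul_inv, le_div_iff₀ (by positivity), mul_comm]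
  have hya : 0 ≤ y ^ α := by positivity
  rcases le_total y x with h | h
  · have := hx0 x ((le_max_left _ _).trans h)
    linarith
  · have h1 : x ^ α ≤ y ^ α := Real.rpow_le_rpow hx.le h hα.le
    have h2 : x ^ α * (ν (Ioi x)).toReal ≤ x ^ α * 1 := by gcongr; exact hprob x
    linarith

lemma tail_lower (α : ℝ) (ν : Measure ℝ) [IsProbabilityMeasure ν]
    (htail : Tendsto (fun x : ℝ => x ^ α * (ν (Set.Ioi x)).toReal) atTop (nhds 1)) :
    ∃ x0, 1 ≤ x0 ∧ ∀ x, x0 ≤ x → 1 / 2 * x ^ (-α) ≤ (ν (Ioi x)).toReal := by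
  obtain ⟨x0, hx0⟩ := eventually_atTop.1 (htail.eventually_const_lt (show (1/2:ℝ) < 1 by norm_num))
  refine ⟨max x0 1, le_max_right _ _, fun x hx => ?_⟩
  have hx1 : 0 < x := by linarith [le_max_right x0 1]
  rw [Real.rpow_neg hx1.le, ← div_eq_mul_inv, div_le_iff₀ (by positivity), mul_comm]
  exact (hx0 x ((le_max_left _ _).trans hx)).le



lemma phi_level1 {s t r u : ℝ} (hs : 0 < s) (hr : 0 < r) (hr1 : r ≤ 1) (hu : 0 ≤ u)
    (h : r < phi s t u) : r ^ (1 / s) < u := by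
  by_contra hcon
  push Not at hcon
  have h1 : r ^ (1/s) ≤ 1 := Real.rpow_le_one hr.le hr1 (by positivity)
  unfold phi at h
  rw [if_pos (hcon.trans h1)] at h
  have h2 : u ^ s ≤ (r ^ (1/s)) ^ s := Real.rpow_le_rpow hu hcon hs.le
  rw [← Real.rpow_mul hr.le, one_div, inv_mul_cancel₀ hs.ne', Real.rpow_one] at h2
  linarith

lemma phi_level2 {s t r u : ℝ} (hs : 0 < s) (ht : 0 < t) (hr1 : 1 < r) (hu : 0 ≤ u)
    (h : r < phi s t u) : r ^ (1 / t) < u := by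
  by_contra hcon
  push Not at hcon
  have hr : 0 < r := by linarith
  unfold phi at h
  split_ifs at h with h0
  · have : u ^ s ≤ 1 := Real.rpow_le_one hu h0 hs.le
    linarith
  have h2 : u ^ t ≤ (r ^ (1/t)) ^ t := Real.rpow_le_rpow hu hcon ht.le
  rw [← Real.rpow_mul hr.le, one_div, inv_mul_cancel₀ ht.ne', Real.rpow_one] at h2
  linarith

lemma phi_lint (α : ℝ) (ν : Measure ℝ) [IsProbabilityMeasure ν] (C0 : ℝ) (hC0 : 0 < C0)
    (hC : ∀ x, 0 < x → (ν (Ioi x)).toReal ≤ C0 * x ^ (-α)) (s t : ℝ) (ht : 0 < t) (hta : t < α)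
    (has : α < s) :
    ∃ C, 0 < C ∧ ∀ y, 0 < y →
      ∫⁻ x, ENNReal.ofReal (phi s t (max x 0 / y)) ∂ν ≤ ENNReal.ofReal (C * y ^ (-α)) := by
  have hs : 0 < s := by linarith
  have hα : 0 < α := by linarith
  have i1 : IntegrableOn (fun r : ℝ => r ^ (-(α / s))) (Ioc 0 1) := by
    rw [← intervalIntegrable_iff_integrableOn_Ioc_of_le zero_le_one]
    apply intervalIntegral.intervalIntegrable_rpow'
    have : α / s < 1 := by rw [div_lt_one hs]; exact has
    linarith
  have i2 : IntegrableOn (fun r : ℝ => r ^ (-(α / t))) (Ioi 1) := by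
    apply integrableOn_Ioi_rpow_of_lt _ zero_lt_one
    have : 1 < α / t := by rw [one_lt_div ht]; exact hta
    linarith
  set I1 := ∫ r in Ioc (0:ℝ) 1, r ^ (-(α / s)) with hI1
  set I2 := ∫ r in Ioi (1:ℝ), r ^ (-(α / t)) with hI2
  have p1 : 0 ≤ I1 := setIntegral_nonneg measurableSet_Ioc fun r hr => Real.rpow_nonneg hr.1.le _
  have p2 : 0 ≤ I2 := setIntegral_nonneg measurableSet_Ioi fun r hr =>
    Real.rpow_nonneg (zero_le_one.trans (le_of_lt hr)) _
  refine ⟨C0 * (I1 + I2 + 1), by positivity, fun y hy => ?_⟩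
  have hmono : Monotone fun x : ℝ => phi s t (max x 0 / y) := by
    intro a b hab
    refine phi_mono hs.le ht.le (div_nonneg (le_max_right _ _) hy.le) ?_
    gcongr
  rw [lintegral_eq_lintegral_meas_lt ν (ae_of_all _ fun x => phi_nonneg s t
    (div_nonneg (le_max_right _ _) hy.le)) hmono.measurable.aemeasurable]
  have key : ∀ (b : ℝ) (r : ℝ), 0 < r → (∀ u, 0 ≤ u → r < phi s t u → r ^ (1/b) < u) →
      ν {x | r < phi s t (max x 0 / y)} ≤ ENNReal.ofReal (C0 * y ^ (-α)) * ENNReal.ofReal (r ^ (-(α / b))) := by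
    intro b r hr hu
    have hyr : 0 < y * r ^ (1/b) := by positivity
    have hsub : {x | r < phi s t (max x 0 / y)} ⊆ Ioi (y * r ^ (1/b)) := by
      intro x hx
      have h1 := hu _ (div_nonneg (le_max_right _ _) hy.le) hx
      rw [lt_div_iff₀ hy] at h1
      have h2 : 0 < max x 0 := by linarith
      have h3 : max x 0 = x := by
        rcases max_choice x 0 with h | h
        · exact h
        · rw [h] at h2; exact absurd h2 (lt_irrefl _)
      rw [h3] at h1
      simp only [mem_Ioi]; linarith
    refine (measure_mono hsub).trans ?_
    rw [← ENNReal.ofReal_mul (by positivity), ← ENNReal.ofReal_toReal (measure_ne_top ν (Ioi _))]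
    apply ENNReal.ofReal_le_ofReal
    refine (hC _ hyr).trans (le_of_eq ?_)
    rw [Real.mul_rpow hy.le (by positivity), ← Real.rpow_mul hr.le, mul_assoc]
    congr 3
    ring
  rw [← Ioc_union_Ioi_eq_Ioi (zero_le_one' ℝ)]
  refine (lintegral_union_le _ _ _).trans ?_
  have b1 : ∫⁻ r in Ioc (0:ℝ) 1, ν {x | r < phi s t (max x 0 / y)} ≤
      ENNReal.ofReal (C0 * y ^ (-α)) * ENNReal.ofReal I1 := by
    rw [hI1, ofReal_integral_eq_lintegral_ofReal i1 ((ae_restrict_iff' measurableSet_Ioc).2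
      (ae_of_all _ fun r hr => Real.rpow_nonneg hr.1.le _)), ← lintegral_const_mul _ (by fun_prop)]
    exact setLIntegral_mono (by fun_prop) fun r hr => key s r hr.1 fun u hu h =>
      phi_level1 hs hr.1 hr.2 hu h
  have b2 : ∫⁻ r in Ioi (1:ℝ), ν {x | r < phi s t (max x 0 / y)} ≤
      ENNReal.ofReal (C0 * y ^ (-α)) * ENNReal.ofReal I2 := by
    rw [hI2, ofReal_integral_eq_lintegral_ofReal i2 ((ae_restrict_iff' measurableSet_Ioi).2
      (ae_of_all _ fun r hr => Real.rpow_nonneg (zero_le_one.trans (le_of_lt hr)) _)), ← lintegral_const_mul _ (by fun_prop)]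
    exact setLIntegral_mono (by fun_prop) fun r hr => key t r (zero_lt_one.trans hr) fun u hu h =>
      phi_level2 hs ht hr hu h
  refine (add_le_add b1 b2).trans ?_
  rw [← mul_add, ← ENNReal.ofReal_add p1 p2, ← ENNReal.ofReal_mul (by positivity)]
  apply ENNReal.ofReal_le_ofReal
  have : 0 < C0 * y ^ (-α) := by positivity
  nlinarith



/-- `fDef` with coordinates truncated below at `1`. -/
def fMax (μ : ℝ) (n k : ℕ) (x : Fin k → ℝ) : ℝ := fDef μ n k (fun a => max (x a) 1)

lemma fDef_meas (μ : ℝ) (n k : ℕ) : Measurable (fDef μ n k) := by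
  unfold fDef
  refine Finset.measurable_prod _ fun p _ => ?_
  fun_prop

lemma fMax_meas (μ : ℝ) (n k : ℕ) : Measurable (fMax μ n k) := by
  unfold fMax
  exact (fDef_meas μ n k).comp (measurable_pi_iff.2 fun a => by fun_prop)

lemma fMax_nonneg {μ : ℝ} (hμ : 0 < μ) (n k : ℕ) (x : Fin k → ℝ) : 0 ≤ fMax μ n k x :=
  fDef_nonneg hμ n k fun a => zero_le_one.trans (le_max_right _ _)

lemma fMax_le_one {μ : ℝ} (hμ : 0 < μ) (n k : ℕ) (x : Fin k → ℝ) : fMax μ n k x ≤ 1 :=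
  fDef_le_one hμ n k fun a => zero_le_one.trans (le_max_right _ _)

lemma fMax_mono {μ : ℝ} (hμ : 0 < μ) (n k : ℕ) : Monotone (fMax μ n k) := fun x y hxy =>
  fDef_mono hμ n k (fun a => zero_le_one.trans (le_max_right _ _))
    (fun a => max_le_max (hxy a) le_rfl)

lemma fMax_int {μ : ℝ} (hμ : 0 < μ) (n k : ℕ) (ν : Measure ℝ) [IsProbabilityMeasure ν] :
    Integrable (fMax μ n k) (Measure.pi fun _ : Fin k => ν) := by
  refine Integrable.of_bound (fMax_meas μ n k).aestronglyMeasurable 1 (ae_of_all _ fun x => ?_)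
  rw [Real.norm_of_nonneg (fMax_nonneg hμ n k x)]
  exact fMax_le_one hμ n k x

lemma ae_ge_one (ν : Measure ℝ) [IsProbabilityMeasure ν] (hsupp : ν (Set.Iio 1) = 0) (k : ℕ) :
    ∀ᵐ x ∂(Measure.pi fun _ : Fin k => ν), ∀ a, 1 ≤ x a := by
  rw [ae_all_iff]
  intro a
  have h : ∀ᵐ y ∂ν, 1 ≤ y := by
    rw [ae_iff]
    convert hsupp using 2
    ext y; simp
  exact (Measure.tendsto_eval_ae_ae (μ := fun _ : Fin k => ν) (i := a)).eventually h

lemma mExp_eq (ν : Measure ℝ) [IsProbabilityMeasure ν] (hsupp : ν (Set.Iio 1) = 0) (μ : ℝ) (k n : ℕ) :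
    mExp ν μ k n = (n.choose k : ℝ) * ∫ x, fMax μ n k x ∂(Measure.pi fun _ : Fin k => ν) := by
  unfold mExp
  congr 1
  have h := ae_ge_one ν hsupp k
  have h1 : (Set.univ.pi (fun _ : Fin k => Set.Ici (1 : ℝ))) =ᵐ[Measure.pi fun _ : Fin k => ν] Set.univ := by
    rw [eventuallyEq_univ]
    filter_upwards [h] with x hx
    exact fun a _ => hx a
  rw [setIntegral_congr_set h1, setIntegral_univ]
  refine integral_congr_ae ?_
  filter_upwards [h] with x hx
  unfold fMax
  congr 1
  funext a
  exact (max_eq_left (hx a)).symm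

lemma low_sum {μ : ℝ} (hμ : 0 < μ) (n k : ℕ) (ν : Measure ℝ) [IsProbabilityMeasure ν]
    (Low : Finset (Fin n)) (w : Fin n → ℝ) (hw : ∀ j, 1 ≤ w j) (K : ℝ) (hK : 0 ≤ K)
    (h : ∀ z, ((Low.filter (fun j => z ≤ w j)).card : ENNReal) ≤ ENNReal.ofReal K * ν (Ici z)) :
    ∑ t ∈ Fintype.piFinset (fun _ : Fin k => Low), fDef μ n k (w ∘ t) ≤
      K ^ k * ∫ x, fMax μ n k x ∂(Measure.pi fun _ : Fin k => ν) := by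
  have h1 := domk ν Low w _ h k (fun x => ENNReal.ofReal (fMax μ n k x))
    (fun x y hxy => ENNReal.ofReal_le_ofReal (fMax_mono hμ n k hxy))
    (fMax_meas μ n k).ennreal_ofReal (fun x => ENNReal.ofReal_ne_top)
  have hI : 0 ≤ ∫ x, fMax μ n k x ∂(Measure.pi fun _ : Fin k => ν) :=
    integral_nonneg fun x => fMax_nonneg hμ n k x
  rw [← ofReal_integral_eq_lintegral_ofReal (fMax_int hμ n k ν) (ae_of_all _ fun x => fMax_nonneg hμ n k x),
    ← ENNReal.ofReal_pow hK, ← ENNReal.ofReal_mul (by positivity),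
    ← ENNReal.ofReal_sum_of_nonneg (fun t _ => fMax_nonneg hμ n k _)] at h1
  have h2 := (ENNReal.ofReal_le_ofReal_iff (by positivity)).1 h1
  refine le_trans (le_of_eq ?_) h2
  refine Finset.sum_congr rfl fun t _ => ?_
  unfold fMax
  congr 1
  funext a
  exact (max_eq_left (hw _)).symm

lemma low_phi {n : ℕ} (ν : Measure ℝ) [IsProbabilityMeasure ν] (s t : ℝ) (hs : 0 ≤ s) (ht : 0 ≤ t)
    (Low : Finset (Fin n)) (w : Fin n → ℝ) (hw : ∀ j, 1 ≤ w j) (K : ℝ) (hK : 0 ≤ K)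
    (h : ∀ z, ((Low.filter (fun j => z ≤ w j)).card : ENNReal) ≤ ENNReal.ofReal K * ν (Ici z))
    (y : ℝ) (hy : 0 < y) (A : ℝ) (hA : 0 ≤ A)
    (hl : ∫⁻ x, ENNReal.ofReal (phi s t (max x 0 / y)) ∂ν ≤ ENNReal.ofReal A) :
    ∑ j ∈ Low, phi s t (w j / y) ≤ K * A := by
  have h1 := dom1 ν Low w _ h (fun x => ENNReal.ofReal (phi s t (max x 0 / y))) (by
    intro a b hab
    refine ENNReal.ofReal_le_ofReal (phi_mono hs ht (div_nonneg (le_max_right _ _) hy.le) ?_)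
    gcongr) (fun x => ENNReal.ofReal_ne_top)
  have h2 := h1.trans (mul_le_mul_right hl _)
  rw [← ENNReal.ofReal_mul hK, ← ENNReal.ofReal_sum_of_nonneg (fun t _ => phi_nonneg _ _
    (div_nonneg (le_max_right _ _) hy.le))] at h2
  have h3 := (ENNReal.ofReal_le_ofReal_iff (by positivity)).1 h2
  refine le_trans (le_of_eq ?_) h3
  refine Finset.sum_congr rfl fun t _ => ?_
  rw [max_eq_left (zero_le_one.trans (hw _))]

lemma choose_ev (k : ℕ) (η : ℝ) (hη : 0 < η) :
    ∀ᶠ n : ℕ in atTop, (n : ℝ) ^ k ≤ (1 + η) * (k.factorial * (n.choose k : ℝ)) := by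
  have h := isEquivalent_choose k
  have hne : ∀ᶠ n : ℕ in atTop, (n : ℝ) ^ k / k.factorial ≠ 0 := by
    filter_upwards [eventually_gt_atTop 0] with n hn
    positivity
  have h1 := (Asymptotics.isEquivalent_iff_tendsto_one hne).1 h
  have h2 := h1.eventually_const_lt (show 1 / (1 + η) < 1 by rw [div_lt_one (by positivity)]; linarith)
  filter_upwards [h2, eventually_gt_atTop 0] with n hn hn0
  simp only [Pi.div_apply] at hn
  have hn0' : (0:ℝ) < n := by exact_mod_cast hn0
  rw [lt_div_iff₀ (by positivity), div_mul_div_comm, div_lt_iff₀ (by positivity)] at hn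
  linarith

lemma sqrt_rpow {μ : ℝ} (hμ : 0 < μ) (α : ℝ) {n : ℕ} (hn : 0 < n) :
    (n : ℝ) * √(μ * n) ^ (-α) = μ ^ (-α / 2) * (n : ℝ) ^ (1 - α / 2) := by
  have hn' : (0 : ℝ) < n := by exact_mod_cast hn
  rw [Real.sqrt_eq_rpow, ← Real.rpow_mul (by positivity), Real.mul_rpow hμ.le hn'.le,
    show 1 / 2 * -α = -α / 2 by ring, show 1 - α / 2 = 1 + -α / 2 by ring, Real.rpow_add hn',
    Real.rpow_one]
  ring

lemma mExp_upper {μ α : ℝ} (hμ : 0 < μ) (h1 : 1 < α) (h2 : α < 2) (ν : Measure ℝ) [IsProbabilityMeasure ν]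
    (hsupp : ν (Set.Iio 1) = 0) (C : ℝ) (hC : 0 < C) {ζ : ℝ} (hζ : ζ = (2 - α) / 7)
    (hphi : ∀ y, 0 < y → ∫⁻ x, ENNReal.ofReal (phi (α + ζ) (α - ζ) (max x 0 / y)) ∂ν ≤
      ENNReal.ofReal (C * y ^ (-α))) (k : ℕ) (hk : 3 ≤ k) (n : ℕ) (hn : 0 < n) :
    mExp ν μ k n ≤ (C * μ ^ (-α / 2)) ^ k * ((n : ℝ) ^ (1 - α / 2)) ^ k := by
  have hn' : (0 : ℝ) < n := by exact_mod_cast hn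
  have hy : 0 < √(μ * n) := by positivity
  rw [mExp_eq ν hsupp]
  have hI : ∫ x, fMax μ n k x ∂(Measure.pi fun _ : Fin k => ν) ≤ (C * √(μ * n) ^ (-α)) ^ k := by
    rw [← ENNReal.ofReal_le_ofReal_iff (by positivity),
      ofReal_integral_eq_lintegral_ofReal (fMax_int hμ n k ν) (ae_of_all _ fun x => fMax_nonneg hμ n k x),
      ENNReal.ofReal_pow (by positivity)]
    have hmono : Monotone fun x : ℝ => phi (α + ζ) (α - ζ) (max x 0 / √(μ * n)) := by
      intro a b hab
      refine phi_mono (by linarith) (by linarith) (div_nonneg (le_max_right _ _) hy.le) ?_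
      gcongr
    refine le_trans ?_ (pow_le_pow_left' (hphi _ hy) k)
    rw [← lint_prod ν k _ hmono.measurable.ennreal_ofReal]
    refine lintegral_mono_ae ?_
    filter_upwards [ae_ge_one ν hsupp k] with x hx
    rw [← ENNReal.ofReal_prod_of_nonneg (fun a _ => phi_nonneg _ _ (div_nonneg (le_max_right _ _) hy.le))]
    apply ENNReal.ofReal_le_ofReal
    have e1 : fMax μ n k x = fDef μ n k x := by
      unfold fMax
      congr 1
      funext a
      exact max_eq_left (hx a)
    rw [e1]
    refine (fDef_le_phi hμ hn (fun a => zero_lt_one.trans_le (hx a)) Finset.univ (by simpa using hk)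
      h1 h2 hζ).trans (le_of_eq ?_)
    refine Finset.prod_congr rfl fun a _ => ?_
    rw [max_eq_left (zero_le_one.trans (hx a))]
  have hc : (n.choose k : ℝ) ≤ (n : ℝ) ^ k := by exact_mod_cast Nat.choose_le_pow n k
  calc _ ≤ (n : ℝ) ^ k * (C * √(μ * n) ^ (-α)) ^ k := by
        gcongr
        exact integral_nonneg fun x => fMax_nonneg hμ n k x
    _ = _ := by
      rw [← mul_pow, ← mul_pow]
      congr 1
      rw [mul_left_comm, sqrt_rpow hμ α hn]; ring

lemma int_lower {μ : ℝ} (hμ : 0 < μ) (ν : Measure ℝ) [IsProbabilityMeasure ν] (k n : ℕ) (hn : 0 < n) :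
    (ν (Ioi √(μ * n))).toReal ^ k ≤ ∫ x, fMax μ n k x ∂(Measure.pi fun _ : Fin k => ν) := by
  have hn' : (0 : ℝ) < n := by exact_mod_cast hn
  set S : Set (Fin k → ℝ) := Set.univ.pi (fun _ => Ioi √(μ * n)) with hS
  have hSm : MeasurableSet S := MeasurableSet.univ_pi fun _ => measurableSet_Ioi
  have e : (ν (Ioi √(μ * n))).toReal ^ k = ∫ x, S.indicator (fun _ => (1:ℝ)) x ∂(Measure.pi fun _ : Fin k => ν) := by
    rw [integral_indicator_const _ hSm, hS, measureReal_def, Measure.pi_pi]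
    simp
  rw [e]
  refine integral_mono_of_nonneg (ae_of_all _ fun x => Set.indicator_nonneg (fun _ _ => zero_le_one) x)
    (fMax_int hμ n k ν) (ae_of_all _ fun x => ?_)
  simp only [Set.indicator]
  split_ifs with hx
  · refine le_of_eq ?_
    unfold fMax fDef
    symm
    refine Finset.prod_eq_one fun p _ => min_eq_right ?_
    rw [le_div_iff₀ (by positivity), one_mul, ← Real.mul_self_sqrt (by positivity : 0 ≤ μ * n)]
    have hh : ∀ a, √(μ * n) ≤ max (x a) 1 := fun a =>
      (le_of_lt (hx a (Set.mem_univ a))).trans (le_max_left _ _)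
    exact mul_le_mul (hh _) (hh _) (Real.sqrt_nonneg _) ((Real.sqrt_nonneg _).trans (hh _))
  · exact fMax_nonneg hμ n k x

lemma mExp_lower {μ α : ℝ} (hμ : 0 < μ) (ν : Measure ℝ) [IsProbabilityMeasure ν]
    (hsupp : ν (Set.Iio 1) = 0) (x0 : ℝ)
    (hl : ∀ x, x0 ≤ x → 1 / 2 * x ^ (-α) ≤ (ν (Ioi x)).toReal) (k : ℕ) :
    ∃ c1, 0 < c1 ∧ ∀ᶠ n : ℕ in atTop, c1 * ((n : ℝ) ^ (1 - α / 2)) ^ k ≤ mExp ν μ k n := by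
  refine ⟨1 / (2 * k.factorial) * (1 / 2 * μ ^ (-α/2)) ^ k, by positivity, ?_⟩
  have ht : Tendsto (fun n : ℕ => √(μ * n)) atTop atTop :=
    Real.tendsto_sqrt_atTop.comp ((tendsto_natCast_atTop_atTop).const_mul_atTop hμ)
  filter_upwards [choose_ev k 1 one_pos, ht.eventually_ge_atTop x0, eventually_gt_atTop 0] with n h1 h2 h3
  have hn' : (0 : ℝ) < n := by exact_mod_cast h3
  rw [mExp_eq ν hsupp]
  have hI := int_lower hμ ν k n h3
  have hG := hl _ h2
  have hc : (n : ℝ) ^ k / (2 * k.factorial) ≤ n.choose k := by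
    rw [div_le_iff₀ (by positivity)]; linarith
  calc _ = (n : ℝ) ^ k / (2 * k.factorial) * (1 / 2 * √(μ * n) ^ (-α)) ^ k := by
        have e1 : ((n : ℝ) * √(μ * n) ^ (-α)) ^ k = (μ ^ (-α / 2) * (n : ℝ) ^ (1 - α / 2)) ^ k := by
          rw [sqrt_rpow hμ α h3]
        rw [mul_pow, mul_pow] at e1
        rw [mul_pow, mul_pow]
        linear_combination (-(1 / (2 * (k.factorial : ℝ)) * (1 / 2) ^ k)) * e1
    _ ≤ (n.choose k : ℝ) * (ν (Ioi √(μ * n))).toReal ^ k := by gcongr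
    _ ≤ _ := by gcongr



lemma hubVec_nonneg (k : ℕ) {x y c : ℝ} (hx : 0 ≤ x) (hy : 0 ≤ y) (hc : 0 ≤ c) (a : Fin k) :
    0 ≤ hubVec k x y c a := by
  unfold hubVec; split_ifs <;> assumption

lemma hubVec_meas (k : ℕ) (c : ℝ) : Measurable fun p : ℝ × ℝ => hubVec k p.1 p.2 c := by
  refine measurable_pi_iff.2 fun a => ?_
  unfold hubVec
  split_ifs
  · exact measurable_fst
  · exact measurable_snd
  · exact measurable_const

lemma fDef_hub_lower {μ : ℝ} (hμ : 0 < μ) {n k : ℕ} (hn : 0 < n) (hk : 2 ≤ k) {x y c : ℝ} (hc : 0 < c)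
    (hcc : μ * n ≤ c ^ 2) (hx : μ * n / c < x) (hy : μ * n / c < y) :
    μ * n / c ^ 2 ≤ fDef μ n k (hubVec k x y c) := by
  have hn' : (0 : ℝ) < n := by exact_mod_cast hn
  have hb0 : 0 < μ * n := by positivity
  have hb1 : μ * n / c ^ 2 ≤ 1 := by rw [div_le_one (by positivity)]; exact hcc
  have hx0 : 0 < x := lt_trans (by positivity) hx
  have hy0 : 0 < y := lt_trans (by positivity) hy
  have hxc : μ * n < x * c := by rwa [div_lt_iff₀ hc] at hx
  have hyc : μ * n < y * c := by rwa [div_lt_iff₀ hc] at hy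
  set p0 : Fin k × Fin k := (⟨0, by omega⟩, ⟨1, by omega⟩) with hp0
  have hmem : p0 ∈ Finset.univ.filter (fun p : Fin k × Fin k => p.1 < p.2) := by
    simp [hp0]
  calc μ * n / c ^ 2 = ∏ p ∈ Finset.univ.filter (fun p : Fin k × Fin k => p.1 < p.2),
        (if p = p0 then μ * n / c ^ 2 else 1) := by
        rw [Finset.prod_ite_eq' _ p0 (fun _ => μ * n / c ^ 2), if_pos hmem]
    _ ≤ _ := by
      unfold fDef
      refine Finset.prod_le_prod (fun p _ => by split_ifs <;> positivity) fun p hp => ?_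
      split_ifs with h
      · rw [h]
        refine le_min ?_ hb1
        simp only [hubVec, hp0]
        simp only [if_true, one_ne_zero, if_false]
        rw [div_le_div_iff₀ (by positivity) (by positivity)]
        have : (μ * n) * (μ * n) ≤ (x * c) * (y * c) := by gcongr
        nlinarith
      · refine (min_eq_right ?_).ge
        rw [le_div_iff₀ (by positivity), one_mul]
        have hlt : p.1.val < p.2.val := (Finset.mem_filter.1 hp).2
        have hne : ¬ (p.1.val = 0 ∧ p.2.val = 1) := by
          rintro ⟨h1, h2⟩
          exact h (Prod.ext (Fin.ext h1) (Fin.ext h2))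
        unfold hubVec
        rw [if_neg (show ¬ p.2.val = 0 by omega)]
        by_cases h1 : p.1.val = 0
        · rw [if_pos h1, if_neg (show ¬ p.2.val = 1 by omega)]; exact hxc.le
        · rw [if_neg h1, if_neg (show ¬ p.2.val = 1 by omega)]
          split_ifs
          · exact hyc.le
          · nlinarith

lemma twoInt_lower {μ : ℝ} (hμ : 0 < μ) (ν : Measure ℝ) [IsProbabilityMeasure ν] {n k : ℕ} (hn : 0 < n)
    (hk : 2 ≤ k) {c : ℝ} (hc : 0 < c) (hcc : μ * n ≤ c ^ 2) (h1 : 1 ≤ μ * n / c) :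
    (ν (Ioi (μ * n / c))).toReal ^ 2 * (μ * n / c ^ 2) ≤ twoInt ν μ k n c := by
  have hn' : (0 : ℝ) < n := by exact_mod_cast hn
  set S := Ioi (μ * n / c) with hS
  have hSs : S ⊆ Ici 1 := fun x hx => h1.trans (le_of_lt hx)
  set b := μ * n / c ^ 2 with hb
  have hb0 : 0 ≤ b := by positivity
  set f : ℝ → ℝ → ℝ := fun x y => fDef μ n k (hubVec k x y c) with hf
  have hm : Measurable (Function.uncurry f) := (fDef_meas μ n k).comp (hubVec_meas k c)
  have hf0 : ∀ x ∈ Ici (1:ℝ), ∀ y ∈ Ici (1:ℝ), 0 ≤ f x y := fun x hx y hy =>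
    fDef_nonneg hμ n k (hubVec_nonneg k (zero_le_one.trans hx) (zero_le_one.trans hy) hc.le)
  have hf1 : ∀ x ∈ Ici (1:ℝ), ∀ y ∈ Ici (1:ℝ), f x y ≤ 1 := fun x hx y hy =>
    fDef_le_one hμ n k (hubVec_nonneg k (zero_le_one.trans hx) (zero_le_one.trans hy) hc.le)
  have hi : ∀ x ∈ Ici (1:ℝ), IntegrableOn (f x) (Ici 1) ν := fun x hx => by
    refine IntegrableOn.of_bound (measure_lt_top _ _) (hm.comp measurable_prodMk_left).aestronglyMeasurable 1 ?_
    refine (ae_restrict_iff' measurableSet_Ici).2 (ae_of_all _ fun y hy => ?_)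
    rw [Real.norm_of_nonneg (hf0 x hx y hy)]; exact hf1 x hx y hy
  have hin : ∀ x ∈ Ici (1:ℝ), 0 ≤ ∫ y in Ici 1, f x y ∂ν := fun x hx =>
    setIntegral_nonneg measurableSet_Ici (hf0 x hx)
  have hlow : ∀ (g : ℝ → ℝ), IntegrableOn g (Ici 1) ν → (∀ x ∈ Ici (1:ℝ), 0 ≤ g x) → ∀ v, (∀ x ∈ S, v ≤ g x) →
      v * (ν S).toReal ≤ ∫ x in Ici 1, g x ∂ν := by
    intro g hg hg0 v hv
    calc v * (ν S).toReal = ∫ x in S, v ∂ν := by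
          rw [setIntegral_const, measureReal_def, smul_eq_mul, mul_comm]
      _ ≤ ∫ x in S, g x ∂ν := setIntegral_mono_on (integrableOn_const (measure_ne_top _ _))
            (hg.mono_set hSs) measurableSet_Ioi hv
      _ ≤ _ := setIntegral_mono_set hg ((ae_restrict_iff' measurableSet_Ici).2 (ae_of_all _ hg0))
            (LE.le.eventuallyLE hSs)
  unfold twoInt
  have h2 := hlow (fun x => ∫ y in Ici 1, f x y ∂ν) (by
    refine IntegrableOn.of_bound (measure_lt_top _ _) (hm.stronglyMeasurable.integral_prod_right).aestronglyMeasurable 1 ?_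
    refine (ae_restrict_iff' measurableSet_Ici).2 (ae_of_all _ fun x hx => ?_)
    rw [Real.norm_of_nonneg (hin x hx)]
    calc ∫ y in Ici 1, f x y ∂ν ≤ ∫ y in Ici 1, (1:ℝ) ∂ν := setIntegral_mono_on (hi x hx)
            (integrableOn_const (measure_ne_top _ _)) measurableSet_Ici (hf1 x hx)
      _ ≤ 1 := by
        rw [setIntegral_const, smul_eq_mul, mul_one]
        exact measureReal_le_one) hin (b * (ν S).toReal) (fun x hx => hlow (f x) (hi x (hSs hx)) (hf0 x (hSs hx)) b
          (fun y hy => fDef_hub_lower hμ hn hk hc hcc hx hy))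
  calc _ = b * (ν S).toReal * (ν S).toReal := by ring
    _ ≤ _ := h2

lemma cA_upper {μ α γ : ℝ} (hμ : 0 < μ) (h1 : 1 < α) (ν : Measure ℝ) [IsProbabilityMeasure ν]
    (x0 : ℝ) (hl : ∀ x, x0 ≤ x → 1 / 2 * x ^ (-α) ≤ (ν (Ioi x)).toReal) (k : ℕ) (hk : 2 ≤ k) (a : ℝ) (ha : 0 < a)
    (C2 : ℝ) (hC2 : 0 < C2) (hup : ∀ n : ℕ, 0 < n → mExp ν μ k n ≤ C2 * ((n : ℝ) ^ (1 - α / 2)) ^ k)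
    (hγ1 : γ < 1) (hγ2 : 1 / 2 < γ) (hγ : 3 - 2 * α + γ * (2 * α - 2) = (1 - α / 2) * k) :
    ∃ C1, 0 < C1 ∧ ∀ᶠ n : ℕ in atTop, cA ν μ k a n ≤ C1 * (n : ℝ) ^ γ := by
  set v := 32 * a * C2 * μ ^ (2 * α - 1) with hv
  have hv0 : 0 < v := by positivity
  set C1 := v ^ (1 / (2 * α - 2)) with hC1
  have hC10 : 0 < C1 := by positivity
  have hC1v : C1 ^ (2 * α - 2) = v := by
    rw [hC1, ← Real.rpow_mul hv0.le, one_div, inv_mul_cancel₀ (by linarith), Real.rpow_one]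
  refine ⟨C1, hC10, ?_⟩
  have t1 : Tendsto (fun n : ℕ => μ / C1 * (n : ℝ) ^ (1 - γ)) atTop atTop :=
    ((tendsto_rpow_atTop (by linarith)).comp tendsto_natCast_atTop_atTop).const_mul_atTop (by positivity)
  have t2 : Tendsto (fun n : ℕ => C1 ^ 2 * (n : ℝ) ^ (2 * γ - 1)) atTop atTop :=
    ((tendsto_rpow_atTop (by linarith)).comp tendsto_natCast_atTop_atTop).const_mul_atTop (by positivity)
  filter_upwards [t1.eventually_ge_atTop (max x0 1), t2.eventually_ge_atTop μ, choose_ev 2 1 one_pos,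
    eventually_gt_atTop 0] with n e1 e2 e3 hn
  have hn' : (0 : ℝ) < n := by exact_mod_cast hn
  set c := C1 * (n : ℝ) ^ γ with hc
  have hc0 : 0 < c := by positivity
  have hmc : μ * n / c = μ / C1 * (n : ℝ) ^ (1 - γ) := by
    rw [hc, Real.rpow_sub hn', Real.rpow_one]; field_simp
  rw [← hmc] at e1
  have hcc : μ * n ≤ c ^ 2 := by
    have : c ^ 2 = C1 ^ 2 * (n : ℝ) ^ (2 * γ - 1) * n := by
      rw [hc, mul_pow, ← Real.rpow_natCast ((n:ℝ) ^ γ) 2, ← Real.rpow_mul hn'.le, Real.rpow_sub hn', Real.rpow_one]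
      field_simp; push_cast; ring_nf
    rw [this]; gcongr
  have h3 := twoInt_lower hμ ν (k := k) hn hk hc0 hcc ((le_max_right _ _).trans e1)
  have h4 := hl _ ((le_max_left _ _).trans e1)
  refine csInf_le ⟨0, fun x hx => hx.1.le⟩ ⟨hc0, ?_⟩
  have h5 : (n : ℝ) ^ 2 / 4 ≤ n.choose 2 := by
    simp [Nat.factorial] at e3
    linarith
  have hy : 0 < μ * n / c := by positivity
  calc a * mExp ν μ k n ≤ a * (C2 * ((n : ℝ) ^ (1 - α / 2)) ^ k) := by gcongr; exact hup n hn
    _ < 2 * (a * (C2 * ((n : ℝ) ^ (1 - α / 2)) ^ k)) := by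
        have : 0 < a * (C2 * ((n : ℝ) ^ (1 - α / 2)) ^ k) := by positivity
        linarith
    _ = (n : ℝ) ^ 2 / 4 * ((1 / 2 * (μ * n / c) ^ (-α)) ^ 2 * (μ * n / c ^ 2)) := by
        rw [← Real.rpow_natCast ((n : ℝ) ^ (1 - α / 2)) k, ← Real.rpow_mul hn'.le, ← hγ]
        have q1 : (1 / 2 * (μ * n / c) ^ (-α)) ^ 2 * (μ * n / c ^ 2) = 1 / 4 * ((μ * n) ^ (1 - 2 * α) * c ^ (2 * α - 2)) := by
          rw [Real.div_rpow (by positivity) hc0.le, Real.rpow_sub (by positivity), Real.rpow_one, Real.rpow_sub hc0,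
            Real.rpow_neg (by positivity), Real.rpow_neg hc0.le, mul_comm 2 α, Real.rpow_mul (by positivity),
            Real.rpow_mul hc0.le, Real.rpow_two, Real.rpow_two, Real.rpow_two]
          field_simp; norm_num
        rw [q1, hc, Real.mul_rpow hC10.le (by positivity), hC1v, ← Real.rpow_mul hn'.le, Real.mul_rpow hμ.le hn'.le,
          show 3 - 2 * α + γ * (2 * α - 2) = 2 + (1 - 2 * α) + γ * (2 * α - 2) by ring, Real.rpow_add hn',
          Real.rpow_add hn', Real.rpow_two, hv, show 1 - 2 * α = -(2 * α - 1) by ring, Real.rpow_neg hμ.le]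
        have : 0 < μ ^ (2 * α - 1) := by positivity
        field_simp; norm_num
    _ ≤ (n.choose 2 : ℝ) * ((ν (Ioi (μ * n / c))).toReal ^ 2 * (μ * n / c ^ 2)) := by gcongr
    _ ≤ _ := by gcongr



/-- class of a vertex of weight `x` -/
def cls (e z0 c0 x : ℝ) : Fin 4 :=
  if e < x then 3 else if x ≤ z0 then 0 else if x ≤ c0 then 1 else 2

lemma cls_spec (e z0 c0 x : ℝ) : (cls e z0 c0 x = 3 → e < x) ∧ (cls e z0 c0 x ≠ 3 → x ≤ e) ∧
    (cls e z0 c0 x = 0 → x ≤ z0) ∧ (cls e z0 c0 x = 1 → z0 < x ∧ x ≤ c0) ∧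
    (cls e z0 c0 x = 2 → c0 < x) := by
  unfold cls
  split_ifs <;> simp_all

lemma good_bound {μ α ζ : ℝ} (hμ : 0 < μ) (h1 : 1 < α) (h2 : α < 2) (hζ : ζ = (2 - α) / 7)
    (ν : Measure ℝ) [IsProbabilityMeasure ν] {k n : ℕ} (hn : 0 < n) (w : Fin n → ℝ) (hw : ∀ j, 1 ≤ w j)
    (δ : ℝ) (hδ : 0 < δ) (hδ1 : δ ≤ 1) (z0 c0 h e : ℝ) (hc0 : 0 < c0) (hh : 0 < h) (he : e ≤ h)
    (i : ℕ) (hi : i + 3 ≤ k) (hLn : Ln e w = i)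
    (hbad : ∀ z ≤ z0, ((Finset.univ.filter (fun j => z ≤ w j)).card : ℝ) ≤ (1 + δ) * n * (ν (Ici z)).toReal)
    (N : ℕ) (hN : (Finset.univ.filter (fun j => c0 < w j)).card ≤ N) (M : ℝ)
    (hM1 : (1 + δ) * n * (ν (Ici z0)).toReal ≤ M) (hM2 : (N : ℝ) + i ≤ M)
    (Ca Cb : ℝ) (hCa : 0 < Ca) (hCb : 0 < Cb)
    (hphia : ∀ y, 0 < y → ∫⁻ x, ENNReal.ofReal (phi (α + ζ) (α - ζ) (max x 0 / y)) ∂ν ≤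
      ENNReal.ofReal (Ca * y ^ (-α)))
    (hphib : ∀ y, 0 < y → ∫⁻ x, ENNReal.ofReal (phi 2 1 (max x 0 / y)) ∂ν ≤
      ENNReal.ofReal (Cb * y ^ (-α))) (B : ℝ)
    (b1 : ∀ q, 3 ≤ q → q < k → (2 * n * (Ca * √(μ * n) ^ (-α))) ^ q * M ^ (k - q) ≤ B)
    (b2 : (μ * n / c0) ^ 2 / (μ * n) * ((2 * n * (Cb * (μ * n / c0) ^ (-α))) ^ 2 * M ^ (k - 2)) ≤ B)
    (b3 : (μ * n / h) ^ 2 / (μ * n) * ((2 * n * (Cb * (μ * n / h) ^ (-α))) ^ 2 * ((N : ℝ) + i) ^ (k - 2)) ≤ B)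
    (b4 : (2 * n * (Cb * (μ * n / h) ^ (-α))) ^ 1 * M ^ (k - 1) ≤ B) (b5 : M ^ k ≤ B) :
    k.factorial * Cful μ k n w ≤ ((1 + δ) * n) ^ k * (∫ x, fMax μ n k x ∂(Measure.pi fun _ : Fin k => ν))
      + 4 ^ k * B := by
  have hn' : (0 : ℝ) < n := by exact_mod_cast hn
  set cl : Fin n → Fin 4 := fun j => cls e z0 c0 (w j) with hcl
  have cl3 : ∀ j, cl j = 3 → e < w j := fun j => (cls_spec e z0 c0 (w j)).1
  have cln3 : ∀ j, cl j ≠ 3 → w j ≤ e := fun j => (cls_spec e z0 c0 (w j)).2.1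
  have cl0 : ∀ j, cl j = 0 → w j ≤ z0 := fun j => (cls_spec e z0 c0 (w j)).2.2.1
  have cl1 : ∀ j, cl j = 1 → z0 < w j ∧ w j ≤ c0 := fun j => (cls_spec e z0 c0 (w j)).2.2.2.1
  have cl2 : ∀ j, cl j = 2 → c0 < w j := fun j => (cls_spec e z0 c0 (w j)).2.2.2.2
  clear_value cl
  have f3 : (fib cl 3).card ≤ i := by
    rw [← hLn]
    refine Finset.card_le_card fun j hj => ?_
    simp only [fib, Finset.mem_filter, Finset.mem_univ, true_and] at hj ⊢
    exact cl3 j hj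
  have f2 : (fib cl 2).card ≤ N := by
    refine le_trans (Finset.card_le_card fun j hj => ?_) hN
    simp only [fib, Finset.mem_filter, Finset.mem_univ, true_and] at hj ⊢
    exact cl2 j hj
  have f1 : ((fib cl 1).card : ℝ) ≤ M := by
    refine le_trans ?_ ((hbad z0 le_rfl).trans hM1)
    refine Nat.cast_le.2 (Finset.card_le_card fun j hj => ?_)
    simp only [fib, Finset.mem_filter, Finset.mem_univ, true_and] at hj ⊢
    exact (cl1 j hj).1.le
  have f3' : ((fib cl 3).card : ℝ) ≤ i := by exact_mod_cast f3
  have f2' : ((fib cl 2).card : ℝ) ≤ N := by exact_mod_cast f2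
  have hi0 : (0:ℝ) ≤ i := Nat.cast_nonneg _
  have hN0 : (0:ℝ) ≤ N := Nat.cast_nonneg _
  have hdom : ∀ z, (((fib cl 0).filter (fun j => z ≤ w j)).card : ENNReal) ≤
      ENNReal.ofReal ((1 + δ) * n) * ν (Ici z) := by
    intro z
    rcases le_or_gt z z0 with hz | hz
    · have h3 : (((fib cl 0).filter (fun j => z ≤ w j)).card : ℝ) ≤ (1 + δ) * n * (ν (Ici z)).toReal := by
        refine le_trans ?_ (hbad z hz)
        exact Nat.cast_le.2 (Finset.card_le_card (Finset.filter_subset_filter _ (Finset.subset_univ _)))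
      have h4 := ENNReal.ofReal_le_ofReal h3
      rwa [ENNReal.ofReal_natCast, ENNReal.ofReal_mul (by positivity), ENNReal.ofReal_toReal (measure_ne_top _ _)] at h4
    · have : (fib cl 0).filter (fun j => z ≤ w j) = ∅ := by
        refine Finset.filter_eq_empty_iff.2 fun j hj => ?_
        simp only [fib, Finset.mem_filter, Finset.mem_univ, true_and] at hj
        have := cl0 j hj
        linarith
      simp [this]
  have hdom2 : ∀ z, (((fib cl 0).filter (fun j => z ≤ w j)).card : ENNReal) ≤
      ENNReal.ofReal (2 * n) * ν (Ici z) := fun z => (hdom z).trans (by gcongr; linarith)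
  have hy1 : 0 < √(μ * n) := by positivity
  have hy2 : 0 < μ * n / c0 := by positivity
  have hy3 : 0 < μ * n / h := by positivity
  refine (Cful_le hμ k n w (fun j => zero_le_one.trans (hw j))).trans ?_
  refine det_bound hμ h1 h2 hζ hn w (fun j => zero_lt_one.trans_le (hw j)) cl i hi f3 M (N + i) c0 h
    _ _ _ _ B ?_ (by linarith) (by linarith) hc0 hh (fun j hj => (cl1 j hj).2) ?_
    (low_sum hμ n k ν _ w hw _ (by positivity) hdom)
    (low_phi ν _ _ (by linarith) (by linarith) _ w hw (2 * n) (by positivity) hdom2 _ hy1 _ (by positivity) (hphia _ hy1))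
    (low_phi ν _ _ (by linarith) (by linarith) _ w hw (2 * n) (by positivity) hdom2 _ hy2 _ (by positivity) (hphib _ hy2))
    (low_phi ν _ _ (by linarith) (by linarith) _ w hw (2 * n) (by positivity) hdom2 _ hy3 _ (by positivity) (hphib _ hy3))
    b1 b2 b3 b4 b5
  · intro c hc
    have : c = 1 ∨ c = 2 ∨ c = 3 := by revert c; decide
    rcases this with rfl | rfl | rfl
    · exact f1
    · linarith
    · linarith
  · intro j hj
    refine (cln3 j ?_).trans he
    rcases hj with h | h <;> rw [h] <;> decide

lemma pow_ev (c p q η : ℝ) (hpq : p < q) (hη : 0 < η) :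
    ∀ᶠ n : ℕ in atTop, c * (n : ℝ) ^ p ≤ η * (n : ℝ) ^ q := by
  have t : Tendsto (fun n : ℕ => (n : ℝ) ^ (q - p)) atTop atTop :=
    (tendsto_rpow_atTop (by linarith)).comp tendsto_natCast_atTop_atTop
  filter_upwards [t.eventually_ge_atTop (c / η), eventually_gt_atTop 0] with n h1 hn
  have hn' : (0 : ℝ) < n := by exact_mod_cast hn
  rw [div_le_iff₀ hη] at h1
  have : (n : ℝ) ^ q = (n : ℝ) ^ (q - p) * (n : ℝ) ^ p := by
    rw [← Real.rpow_add hn']; congr 1; ring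
  rw [this]
  have h0 : 0 < (n : ℝ) ^ p := by positivity
  nlinarith

lemma decay_ev (ρ κ D : ℝ) (h0 : 0 < ρ) (h1 : ρ < 1) (hκ : 0 < κ) :
    ∀ᶠ n : ℕ in atTop, ((n : ℝ) + 1) * ρ ^ ⌊(n : ℝ) ^ κ / 2⌋₊ ≤ (n : ℝ) ^ (-D) := by
  set b := - Real.log ρ / 2 with hb
  have hlog : Real.log ρ < 0 := Real.log_neg h0 h1
  have hb0 : 0 < b := by rw [hb]; linarith
  have t := (tendsto_rpow_mul_exp_neg_mul_atTop_nhds_zero ((D + 1) / κ) b hb0).comp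
    ((tendsto_rpow_atTop hκ).comp tendsto_natCast_atTop_atTop)
  filter_upwards [t.eventually_lt_const (show 0 < ρ / 2 by positivity), eventually_gt_atTop 0] with n h2 hn
  have hn' : (0 : ℝ) < n := by exact_mod_cast hn
  have hn1 : (1 : ℝ) ≤ n := by exact_mod_cast hn
  simp only [Function.comp] at h2
  rw [← Real.rpow_mul hn'.le, mul_div_cancel₀ _ hκ.ne'] at h2
  have h3 : ρ ^ ⌊(n : ℝ) ^ κ / 2⌋₊ ≤ ρ⁻¹ * Real.exp (-b * (n : ℝ) ^ κ) := by
    rw [← Real.rpow_natCast]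
    have hf : (n : ℝ) ^ κ / 2 - 1 ≤ (⌊(n : ℝ) ^ κ / 2⌋₊ : ℝ) := (Nat.sub_one_lt_floor _).le
    refine (Real.rpow_le_rpow_of_exponent_ge h0 h1.le hf).trans (le_of_eq ?_)
    rw [Real.rpow_sub h0, Real.rpow_one, Real.rpow_def_of_pos h0, hb, div_eq_mul_inv, mul_comm]
    congr 2
    ring
  have h4 : (n : ℝ) ^ (D + 1) = (n : ℝ) ^ D * n := by rw [Real.rpow_add hn', Real.rpow_one]
  rw [h4] at h2
  rw [Real.rpow_neg hn'.le, ← one_div, le_div_iff₀ (by positivity)]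
  set E := Real.exp (-b * (n : ℝ) ^ κ)
  have hD : 0 < (n : ℝ) ^ D := by positivity
  calc ((n : ℝ) + 1) * ρ ^ ⌊(n : ℝ) ^ κ / 2⌋₊ * (n : ℝ) ^ D ≤ (2 * n) * (ρ⁻¹ * E) * (n : ℝ) ^ D := by
        gcongr; linarith
    _ = 2 * ρ⁻¹ * ((n : ℝ) ^ D * n * E) := by ring
    _ ≤ 2 * ρ⁻¹ * (ρ / 2) := by gcongr
    _ = 1 := by field_simp

lemma params {α : ℝ} {k : ℕ} (h1 : 1 < α) (h2 : α < 2) (hk : 4 ≤ k) (h3 : 2 - 2 / (k : ℝ) < α) :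
    ∃ γ β κ : ℝ, γ < 1 ∧ 1 / 2 < γ ∧ 3 - 2 * α + γ * (2 * α - 2) = (1 - α / 2) * k ∧
      1 < α * β ∧ β < γ ∧ 0 < κ ∧ κ < 1 - α / 2 ∧
      3 - 2 * α + β * (2 * α - 2) + κ * k < (1 - α / 2) * k ∧
      1 - α + α * γ + κ * k < (1 - α / 2) * k := by
  have hk' : (4 : ℝ) ≤ k := by exact_mod_cast hk
  have hkd : (1 - α / 2) * k < 1 := by
    have : (2 - 2 / (k:ℝ)) * k < α * k := by gcongr
    rw [sub_mul, div_mul_cancel₀ _ (by linarith)] at this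
    linarith
  set γ := 1 - (1 - (1 - α / 2) * k) / (2 * α - 2) with hγ
  have e1 : (1 - γ) * (2 * α - 2) = 1 - (1 - α / 2) * k := by
    rw [hγ, sub_sub_cancel, div_mul_cancel₀ _ (by linarith)]
  have g1 : γ < 1 := by
    by_contra hcon
    push Not at hcon
    nlinarith
  have g2 : 1 < α * γ := by
    have : α * ((1 - γ) * (2 * α - 2)) < (α - 1) * (2 * α - 2) := by
      rw [e1]
      have : (1 - α / 2) * k ≥ (1 - α / 2) * 4 := by
        have : 0 < 1 - α / 2 := by linarith
        gcongr
      nlinarith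
    have h4 : α * (1 - γ) < α - 1 := by
      have : (α * (1 - γ)) * (2 * α - 2) < (α - 1) * (2 * α - 2) := by linarith
      exact lt_of_mul_lt_mul_right this (by linarith)
    linarith
  have g3 : 1 / α < γ := by rw [div_lt_iff₀ (by linarith)]; linarith
  set β := (1 / α + γ) / 2 with hβ
  have b1 : 1 / α < β := by linarith
  have b2 : β < γ := by linarith
  have b3 : 1 < α * β := by rw [div_lt_iff₀ (by linarith)] at b1; linarith
  have p1 : 0 < (γ - β) * (2 * α - 2) := mul_pos (by linarith) (by linarith)
  have p2 : 0 < (1 - γ) * (2 - α) := mul_pos (by linarith) (by linarith)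
  have p3 : 0 < 1 - α / 2 := by linarith
  set m := min (1 - α / 2) (min ((γ - β) * (2 * α - 2)) ((1 - γ) * (2 - α))) with hm
  have m0 : 0 < m := lt_min p3 (lt_min p1 p2)
  have m1 : m ≤ 1 - α / 2 := min_le_left _ _
  have m2 : m ≤ (γ - β) * (2 * α - 2) := (min_le_right _ _).trans (min_le_left _ _)
  have m3 : m ≤ (1 - γ) * (2 - α) := (min_le_right _ _).trans (min_le_right _ _)
  have hmk : m / (2 * k) * k = m / 2 := by field_simp
  have hmk2 : m / (2 * k) < m := by
    rw [div_lt_iff₀ (by linarith)]; nlinarith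
  refine ⟨γ, β, m / (2 * k), g1, ?_, by linarith, b3, b2, by positivity, by linarith, ?_, ?_⟩
  · nlinarith
  · rw [hmk]; nlinarith
  · rw [hmk]; nlinarith



lemma A_eq {μ α γ H Cb N : ℝ} (hμ : 0 < μ) (hH : 0 < H) (hN : 0 < N) :
    2 * N * (Cb * (μ * N / (H * N ^ γ)) ^ (-α)) = (2 * Cb * (μ / H) ^ (-α)) * N ^ (1 - α + α * γ) := by
  have e : μ * N / (H * N ^ γ) = (μ / H) * N ^ (1 - γ) := by
    rw [Real.rpow_sub hN, Real.rpow_one]; field_simp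
  rw [e, Real.mul_rpow (by positivity) (by positivity), ← Real.rpow_mul hN.le,
    show 1 - α + α * γ = 1 + (1 - γ) * -α by ring, Real.rpow_add hN, Real.rpow_one]
  ring

lemma sq_eq {μ γ H N : ℝ} (hμ : 0 < μ) (hH : 0 < H) (hN : 0 < N) :
    (μ * N / (H * N ^ γ)) ^ 2 / (μ * N) = (μ / H ^ 2) * N ^ (1 - 2 * γ) := by
  rw [Real.rpow_sub hN, Real.rpow_one, mul_comm 2 γ, Real.rpow_mul hN.le, Real.rpow_two]
  field_simp

lemma pow_form {N c p : ℝ} (hN : 0 < N) (q : ℕ) : (c * N ^ p) ^ q = c ^ q * N ^ (p * q) := by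
  rw [mul_pow, ← Real.rpow_natCast (N ^ p) q, ← Real.rpow_mul hN.le]

lemma b_ev {μ α γ β κ : ℝ} (hμ : 0 < μ) (h1 : 1 < α) (h2 : α < 2) {k : ℕ} (hk : 4 ≤ k)
    (hγ : 3 - 2 * α + γ * (2 * α - 2) = (1 - α / 2) * k)
    (hκ0 : 0 < κ) (hκ : κ < 1 - α / 2)
    (e2 : 3 - 2 * α + β * (2 * α - 2) + κ * k < (1 - α / 2) * k)
    (e4 : 1 - α + α * γ + κ * k < (1 - α / 2) * k)
    (Ca Cb C1 CM ε η Nr : ℝ) (hC1 : 0 < C1) (hε : 0 < ε) (hη : 0 < η)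
    (hQ : 4 * Cb ^ 2 * μ ^ (1 - 2 * α) * C1 ^ (2 * α - 2) * Nr ^ (k - 2) * ε ^ (2 * α - 2) ≤ η) :
    ∀ᶠ n : ℕ in atTop,
      (∀ q, 3 ≤ q → q < k → (2 * n * (Ca * √(μ * n) ^ (-α))) ^ q * (CM * (n : ℝ) ^ κ) ^ (k - q) ≤
        η * ((n : ℝ) ^ (1 - α / 2)) ^ k) ∧
      (μ * n / (n : ℝ) ^ β) ^ 2 / (μ * n) * ((2 * n * (Cb * (μ * n / (n : ℝ) ^ β) ^ (-α))) ^ 2 *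
        (CM * (n : ℝ) ^ κ) ^ (k - 2)) ≤ η * ((n : ℝ) ^ (1 - α / 2)) ^ k ∧
      (μ * n / (ε * C1 * (n : ℝ) ^ γ)) ^ 2 / (μ * n) *
        ((2 * n * (Cb * (μ * n / (ε * C1 * (n : ℝ) ^ γ)) ^ (-α))) ^ 2 * Nr ^ (k - 2)) ≤
          η * ((n : ℝ) ^ (1 - α / 2)) ^ k ∧
      (2 * n * (Cb * (μ * n / (ε * C1 * (n : ℝ) ^ γ)) ^ (-α))) ^ 1 * (CM * (n : ℝ) ^ κ) ^ (k - 1) ≤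
          η * ((n : ℝ) ^ (1 - α / 2)) ^ k ∧
      (CM * (n : ℝ) ^ κ) ^ k ≤ η * ((n : ℝ) ^ (1 - α / 2)) ^ k := by
  have hk' : (4 : ℝ) ≤ k := by exact_mod_cast hk
  have hk2 : ((k - 2 : ℕ) : ℝ) = k - 2 := by rw [Nat.cast_sub (by omega)]; norm_num
  have hk1 : ((k - 1 : ℕ) : ℝ) = k - 1 := by rw [Nat.cast_sub (by omega)]; norm_num
  have E1 : ∀ᶠ n : ℕ in atTop, ∀ q ∈ Finset.range k,
      ((2 * Ca * μ ^ (-α / 2)) ^ q * CM ^ (k - q)) * (n : ℝ) ^ ((1 - α / 2) * q + κ * ((k - q : ℕ) : ℝ)) ≤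
        η * (n : ℝ) ^ ((1 - α / 2) * k) := by
    rw [eventually_all_finset]
    intro q hq
    have hq := Finset.mem_range.1 hq
    refine pow_ev _ _ _ _ ?_ hη
    rw [Nat.cast_sub hq.le]
    have : (q : ℝ) < k := by exact_mod_cast hq
    nlinarith
  have E2 := pow_ev (μ / 1 ^ 2 * ((2 * Cb * (μ / 1) ^ (-α)) ^ 2 * CM ^ (k - 2)))
    ((1 - 2 * β) + ((1 - α + α * β) * (2 : ℕ) + κ * ((k - 2 : ℕ) : ℝ))) ((1 - α / 2) * k) η (by
      rw [hk2]; push_cast; nlinarith) hη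
  have E4 := pow_ev ((2 * Cb * (μ / (ε * C1)) ^ (-α)) * CM ^ (k - 1))
    ((1 - α + α * γ) + κ * ((k - 1 : ℕ) : ℝ)) ((1 - α / 2) * k) η (by
      rw [hk1]; nlinarith) hη
  have E5 := pow_ev (CM ^ k) (κ * k) ((1 - α / 2) * k) η (by nlinarith) hη
  filter_upwards [E1, E2, E4, E5, eventually_gt_atTop 0] with n E1 E2 E4 E5 hn
  have hn' : (0 : ℝ) < n := by exact_mod_cast hn
  have hX : ((n : ℝ) ^ (1 - α / 2)) ^ k = (n : ℝ) ^ ((1 - α / 2) * k) := by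
    rw [← Real.rpow_natCast, ← Real.rpow_mul hn'.le]
  rw [hX]
  have hH : 0 < ε * C1 := by positivity
  refine ⟨fun q hq3 hq => ?_, ?_, ?_, ?_, ?_⟩
  · refine le_trans (le_of_eq ?_) (E1 q (Finset.mem_range.2 hq))
    rw [show 2 * (n : ℝ) * (Ca * √(μ * n) ^ (-α)) = 2 * Ca * μ ^ (-α / 2) * (n : ℝ) ^ (1 - α / 2) by
      rw [mul_assoc (2 * Ca), ← sqrt_rpow hμ α hn]; ring]
    rw [pow_form hn', pow_form hn', Real.rpow_add hn']
    ring
  · refine le_trans (le_of_eq ?_) E2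
    have a1 := A_eq (α := α) (γ := β) (Cb := Cb) hμ one_pos hn'
    have a2 := sq_eq (γ := β) hμ one_pos hn'
    rw [one_mul] at a1 a2
    rw [a1, a2, pow_form hn', pow_form hn', Real.rpow_add hn', Real.rpow_add hn']
    ring
  · rw [A_eq hμ hH hn', sq_eq hμ hH hn', pow_form hn', ← hγ]
    have hx : (n : ℝ) ^ (3 - 2 * α + γ * (2 * α - 2)) = (n : ℝ) ^ (1 - 2 * γ) * (n : ℝ) ^ ((1 - α + α * γ) * (2 : ℕ)) := by
      rw [← Real.rpow_add hn']; congr 1; push_cast; ring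
    rw [hx]
    have hq : μ / (ε * C1) ^ 2 * ((2 * Cb * (μ / (ε * C1)) ^ (-α)) ^ 2 * Nr ^ (k - 2)) =
        4 * Cb ^ 2 * μ ^ (1 - 2 * α) * C1 ^ (2 * α - 2) * Nr ^ (k - 2) * ε ^ (2 * α - 2) := by
      rw [Real.div_rpow hμ.le hH.le, Real.rpow_neg hμ.le, Real.rpow_neg hH.le, Real.rpow_sub hμ, Real.rpow_sub hC1,
        Real.rpow_sub hε, mul_comm 2 α, Real.rpow_mul hμ.le, Real.rpow_mul hC1.le, Real.rpow_mul hε.le,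
        Real.mul_rpow hε.le hC1.le]
      simp only [Real.rpow_two, Real.rpow_one]
      field_simp; ring
    calc _ = (μ / (ε * C1) ^ 2 * ((2 * Cb * (μ / (ε * C1)) ^ (-α)) ^ 2 * Nr ^ (k - 2))) *
          ((n : ℝ) ^ (1 - 2 * γ) * (n : ℝ) ^ ((1 - α + α * γ) * (2 : ℕ))) := by ring
      _ ≤ _ := by rw [hq]; gcongr
  · refine le_trans (le_of_eq ?_) E4
    rw [pow_one, A_eq hμ hH hn', pow_form hn', Real.rpow_add hn' (1 - α + α * γ) (κ * ((k - 1 : ℕ) : ℝ))]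
    ring
  · refine le_trans (le_of_eq ?_) E5
    rw [pow_form hn']



set_option maxHeartbeats 2000000 in
/-- for `α > 2 - 2/k`, `a > 0` and `1 ≤ i < k-2`, there is `ε > 0` with
`P(C_n > (1+a) m_n^{(k)}, L_n(ε c_a(n)) = i) = O((n P(W > c_a(n)))^{k-2})`. -/
theorem stmt10
    (α : ℝ) (hα : α ∈ Set.Ioo (1 : ℝ) 2)
    (ν : Measure ℝ) [IsProbabilityMeasure ν]
    (hsupp : ν (Set.Iio 1) = 0)
    (htail : Tendsto (fun x : ℝ => x ^ α * (ν (Set.Ioi x)).toReal) atTop (nhds 1))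
    (hint : Integrable (fun x : ℝ => x) ν)
    (μ : ℝ) (hμ : μ = ∫ x, x ∂ν)
    (k : ℕ) (hk : 3 ≤ k)
    (hα2 : 2 - 2 / (k : ℝ) < α)
    (a : ℝ) (ha : 0 < a)
    (i : ℕ) (hi1 : 1 ≤ i) (hi2 : i < k - 2) :
    ∃ ε : ℝ, 0 < ε ∧ ∃ C : ℝ, ∃ n₀ : ℕ, 0 < C ∧ ∀ n, n₀ ≤ n →
      ((Measure.pi fun _ : Fin n => ν)
          {w | (1 + a) * mExp ν μ k n < Cful μ k n w ∧
            Ln (ε * cA ν μ k a n) w = i}).toReal ≤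
        C * ((n : ℝ) * (ν (Set.Ioi (cA ν μ k a n))).toReal) ^ (k - 2) := by
  obtain ⟨h1, h2⟩ := hα
  have hk4 : 4 ≤ k := by omega
  have hae : ∀ᵐ y ∂ν, 1 ≤ y := by
    rw [ae_iff]
    convert hsupp using 2
    ext y; simp
  have hμ0 : 0 < μ := by
    have : (1 : ℝ) ≤ ∫ x, x ∂ν := by
      calc (1 : ℝ) = ∫ x, (1 : ℝ) ∂ν := by simp
        _ ≤ _ := integral_mono_ae (integrable_const _) hint hae
    rw [hμ]; linarith
  clear hμ
  obtain ⟨γ, β, κ, hγ1, hγ2, hγ, hαβ, hβγ, hκ0, hκ, e2, e4⟩ := params h1 h2 hk4 hα2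
  obtain ⟨C0, hC0, hup⟩ := tail_upper α (by linarith) ν htail
  obtain ⟨x0, hx0, hlo⟩ := tail_lower α ν htail
  set ζ := (2 - α) / 7 with hζ
  obtain ⟨Ca, hCa, hphia⟩ := phi_lint α ν C0 hC0 hup (α + ζ) (α - ζ) (by linarith) (by linarith) (by linarith)
  obtain ⟨Cb, hCb, hphib⟩ := phi_lint α ν C0 hC0 hup 2 1 one_pos h1 h2
  have hmup := mExp_upper hμ0 h1 h2 ν hsupp Ca hCa hζ hphia k hk
  obtain ⟨c1, hc1, hmlo⟩ := mExp_lower (α := α) hμ0 ν hsupp x0 hlo k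
  obtain ⟨C1, hC1, hcA⟩ := cA_upper hμ0 h1 ν x0 hlo k (by omega) a ha _ (by positivity) hmup hγ1 hγ2 hγ
  -- choice of `δ`
  obtain ⟨δ, hδ0, hδ1, hδ⟩ : ∃ δ : ℝ, 0 < δ ∧ δ ≤ 1 ∧ (1 + δ) ^ (k + 1) ≤ 1 + a / 2 := by
    have hb : 1 < (1 + a / 2) ^ (((k + 1 : ℕ) : ℝ)⁻¹) :=
      Real.one_lt_rpow (by linarith) (by positivity)
    refine ⟨min 1 ((1 + a / 2) ^ (((k + 1 : ℕ) : ℝ)⁻¹) - 1), lt_min one_pos (by linarith), min_le_left _ _, ?_⟩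
    calc _ ≤ ((1 + a / 2) ^ (((k + 1 : ℕ) : ℝ)⁻¹)) ^ (k + 1) := by
          refine pow_le_pow_left₀ ?_ ?_ _
          · have : 0 < min 1 ((1 + a / 2) ^ (((k + 1 : ℕ) : ℝ)⁻¹) - 1) := lt_min one_pos (by linarith)
            linarith
          · linarith [min_le_right 1 ((1 + a / 2) ^ (((k + 1 : ℕ) : ℝ)⁻¹) - 1)]
      _ = _ := Real.rpow_inv_natCast_pow (by positivity) (by omega)
  set η := a / 2 * c1 / 4 ^ k with hη
  have hη0 : 0 < η := by positivity
  set D := (α * γ - 1) * ((k - 2 : ℕ) : ℝ) with hD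
  obtain ⟨N, hN⟩ := exists_nat_ge (D / (α * β - 1))
  rw [div_le_iff₀ (by linarith)] at hN
  -- choice of `ε`
  set Q := 4 * Cb ^ 2 * μ ^ (1 - 2 * α) * C1 ^ (2 * α - 2) * ((N : ℝ) + i) ^ (k - 2) with hQ
  have hQ0 : 0 < Q := by
    have : (0 : ℝ) < i := by exact_mod_cast hi1
    positivity
  set ε := (η / Q) ^ (1 / (2 * α - 2)) with hε
  have hε0 : 0 < ε := by positivity
  have hεQ : Q * ε ^ (2 * α - 2) ≤ η := by
    rw [hε, ← Real.rpow_mul (by positivity), one_div, inv_mul_cancel₀ (by linarith), Real.rpow_one]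
    exact le_of_eq (by field_simp)
  set CM := 2 * C0 * 2 ^ α + (N + i) with hCM
  have hb := b_ev hμ0 h1 h2 hk4 hγ hκ0 hκ e2 e4 Ca Cb C1 CM ε η (N + i) hC1 hε0 hη0 hεQ
  set ρ := Real.exp (δ / (1 + δ)) / (1 + δ) with hρ
  have hρ0 : 0 < ρ := by positivity
  have hρ1 : ρ < 1 := rho_lt_one δ hδ0
  have hdec := decay_ev ρ κ D hρ0 hρ1 hκ0
  set τ := (1 - κ) / α with hτ
  have hτ0 : 0 < τ := div_pos (by linarith) (by linarith)
  have hτα : τ * α = 1 - κ := div_mul_cancel₀ _ (by linarith)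
  have tz : Tendsto (fun n : ℕ => (n : ℝ) ^ τ) atTop atTop :=
    (tendsto_rpow_atTop hτ0).comp tendsto_natCast_atTop_atTop
  have tc : Tendsto (fun n : ℕ => C1 * (n : ℝ) ^ γ) atTop atTop :=
    ((tendsto_rpow_atTop (by linarith)).comp tendsto_natCast_atTop_atTop).const_mul_atTop hC1
  have hlev := pow_ev C0 (1 - α * β) 0 1 (by linarith) one_pos
  have hch := choose_ev k δ hδ0
  set G0 := (1 / 2 * C1 ^ (-α)) ^ (k - 2) with hG0
  have hG00 : 0 < G0 := by positivity
  refine ⟨ε, hε0, (1 + Real.exp 1 * C0 ^ N) / G0, ?_⟩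
  obtain ⟨n0, hn0⟩ := eventually_atTop.1 (hb.and (hdec.and (hcA.and (hmlo.and (hch.and
    ((tz.eventually_ge_atTop x0).and ((tc.eventually_ge_atTop x0).and (hlev.and (eventually_gt_atTop 0)))))))))
  refine ⟨n0, by positivity, fun n hn => ?_⟩
  obtain ⟨⟨b1, b2, b3, b4, b5⟩, hdec, hcA, hmlo, hch, hz, hc, hlev, hnp⟩ := hn0 n hn
  have hn' : (0 : ℝ) < n := by exact_mod_cast hnp
  have hn1 : (1 : ℝ) ≤ n := by exact_mod_cast hnp
  rw [Real.rpow_zero, one_mul] at hlev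
  set z0 := (n : ℝ) ^ τ with hz0
  have hz00 : 0 < z0 := by positivity
  have hzα : z0 ^ (-α) * n = (n : ℝ) ^ κ := by
    rw [hz0, ← Real.rpow_mul hn'.le, mul_neg, hτα]
    nth_rewrite 2 [← Real.rpow_one (n : ℝ)]
    rw [← Real.rpow_add hn']; congr 1; ring
  -- the lower tail at `z0`
  have hm0 : ((⌊(n : ℝ) ^ κ / 2⌋₊ : ℕ) : ℝ) ≤ (1 + δ) * n * (ν (Ici z0)).toReal := by
    have q1 : (ν (Ioi z0)).toReal ≤ (ν (Ici z0)).toReal :=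
      ENNReal.toReal_mono (measure_ne_top _ _) (measure_mono Ioi_subset_Ici_self)
    have q2 := hlo z0 hz
    calc ((⌊(n : ℝ) ^ κ / 2⌋₊ : ℕ) : ℝ) ≤ (n : ℝ) ^ κ / 2 := Nat.floor_le (by positivity)
      _ = 1 * n * (1 / 2 * z0 ^ (-α)) := by rw [← hzα]; ring
      _ ≤ _ := by
        gcongr
        · linarith
        · exact q2.trans q1
  have hM1 : (1 + δ) * n * (ν (Ici z0)).toReal ≤ CM * (n : ℝ) ^ κ := by
    have q1 : (ν (Ici z0)).toReal ≤ (ν (Ioi (z0 / 2))).toReal :=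
      ENNReal.toReal_mono (measure_ne_top _ _) (measure_mono (fun x hx => by
        simp only [mem_Ioi, mem_Ici] at *; linarith))
    have q2 := hup (z0 / 2) (by positivity)
    have q3 : (z0 / 2) ^ (-α) = 2 ^ α * z0 ^ (-α) := by
      rw [Real.div_rpow hz00.le (by norm_num), Real.rpow_neg (by norm_num : (0:ℝ) ≤ 2), div_inv_eq_mul, mul_comm]
    calc (1 + δ) * n * (ν (Ici z0)).toReal ≤ 2 * n * (C0 * (2 ^ α * z0 ^ (-α))) := by
          rw [← q3]
          gcongr
          · linarith
          · exact q1.trans q2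
      _ = 2 * C0 * 2 ^ α * (n : ℝ) ^ κ := by rw [← hzα]; ring
      _ ≤ _ := by
        rw [hCM]
        gcongr
        have : (0:ℝ) ≤ (N:ℝ) + i := by positivity
        linarith
  have hM2 : (N : ℝ) + i ≤ CM * (n : ℝ) ^ κ := by
    have q1 : (1:ℝ) ≤ (n : ℝ) ^ κ := Real.one_le_rpow hn1 hκ0.le
    have q2 : 0 ≤ 2 * C0 * 2 ^ α := by positivity
    have q3 : (0:ℝ) ≤ (N:ℝ) + i := by positivity
    rw [hCM]
    nlinarith
  set π := Measure.pi fun _ : Fin n => ν with hπ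
  set c0 := (n : ℝ) ^ β with hc0
  have hc00 : 0 < c0 := by positivity
  set l := C0 * (n : ℝ) ^ (1 - α * β) with hl
  have hnl : n * (ν (Ioi c0)).toReal ≤ l := by
    calc n * (ν (Ioi c0)).toReal ≤ n * (C0 * c0 ^ (-α)) := by gcongr; exact hup c0 hc00
      _ = l := by
        rw [hl, hc0, ← Real.rpow_mul hn'.le, Real.rpow_sub hn', Real.rpow_one, mul_neg, Real.rpow_neg hn'.le,
          mul_comm β α]
        ring
  set bad : Set (Fin n → ℝ) := {w | ∃ z ≤ z0, (1 + δ) * n * (ν (Ici z)).toReal <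
        ((Finset.univ.filter (fun j => z ≤ w j)).card : ℝ)} with hbad
  set E2 : Set (Fin n → ℝ) := {w | N ≤ (Finset.univ.filter (fun j => c0 < w j)).card} with hE2
  have pbad : π bad ≤ ENNReal.ofReal ((n : ℝ) ^ (-D)) :=
    (bad_prob ν δ hδ0 n hnp z0 _ hm0).trans (ENNReal.ofReal_le_ofReal hdec)
  have pE2 : π E2 ≤ ENNReal.ofReal (Real.exp 1 * C0 ^ N * (n : ℝ) ^ (-D)) := by
    refine (many_prob ν n c0 l (by positivity) hlev hnl N).trans (ENNReal.ofReal_le_ofReal ?_)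
    rw [hl, pow_form hn', mul_assoc]
    gcongr
    linarith
  have p1 : π {w | ¬ ∀ j, 1 ≤ w j} = 0 := ae_iff.1 (ae_ge_one ν hsupp n)
  have hsub : {w | (1 + a) * mExp ν μ k n < Cful μ k n w ∧ Ln (ε * cA ν μ k a n) w = i} ⊆
      {w | ¬ ∀ j, 1 ≤ w j} ∪ (bad ∪ E2) := by
    rintro w ⟨hw1, hw2⟩
    by_contra hcon
    simp only [mem_union, not_or] at hcon
    obtain ⟨g1, g2, g3⟩ := hcon
    simp only [Set.mem_ofPred_eq, not_not] at g1
    have g2' : ∀ z ≤ z0, ((Finset.univ.filter (fun j => z ≤ w j)).card : ℝ) ≤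
        (1 + δ) * n * (ν (Ici z)).toReal := by
      intro z hz
      by_contra hcon
      exact g2 ⟨z, hz, not_le.1 hcon⟩
    have g3' : (Finset.univ.filter (fun j => c0 < w j)).card ≤ N := (not_le.1 g3).le
    have hfin := good_bound hμ0 h1 h2 hζ ν hnp w g1 δ hδ0 hδ1 z0 c0 (ε * C1 * (n : ℝ) ^ γ)
      (ε * cA ν μ k a n) hc00 (by positivity) (by rw [mul_assoc]; gcongr) i (by omega) hw2 g2' N g3'
      (CM * (n : ℝ) ^ κ) hM1 hM2 Ca Cb hCa hCb hphia hphib (η * ((n : ℝ) ^ (1 - α / 2)) ^ k) b1 b2 b3 b4 b5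
    have hme := mExp_eq ν hsupp μ k n
    set I := ∫ x, fMax μ n k x ∂(Measure.pi fun _ : Fin k => ν) with hI
    have hI0 : 0 ≤ I := integral_nonneg fun x => fMax_nonneg hμ0 n k x
    have hf1 : (1 : ℝ) ≤ k.factorial := by exact_mod_cast Nat.factorial_pos k
    have k1 : ((1 + δ) * n) ^ k * I ≤ k.factorial * ((1 + a / 2) * mExp ν μ k n) := by
      have : ((1 + δ) * n) ^ k ≤ (1 + a / 2) * (k.factorial * (n.choose k : ℝ)) := by
        calc ((1 + δ) * (n:ℝ)) ^ k = (1 + δ) ^ k * (n : ℝ) ^ k := mul_pow _ _ _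
          _ ≤ (1 + δ) ^ k * ((1 + δ) * (k.factorial * (n.choose k : ℝ))) := by gcongr
          _ = (1 + δ) ^ (k + 1) * (k.factorial * (n.choose k : ℝ)) := by rw [pow_succ]; ring
          _ ≤ _ := by gcongr
      calc _ ≤ (1 + a / 2) * (k.factorial * (n.choose k : ℝ)) * I := by gcongr
        _ = _ := by rw [hme]; ring
    have k2 : 4 ^ k * (η * ((n : ℝ) ^ (1 - α / 2)) ^ k) ≤ k.factorial * (a / 2 * mExp ν μ k n) := by
      have hm0 : 0 ≤ mExp ν μ k n := by rw [hme]; positivity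
      calc 4 ^ k * (η * ((n : ℝ) ^ (1 - α / 2)) ^ k) = a / 2 * (c1 * ((n : ℝ) ^ (1 - α / 2)) ^ k) := by
            rw [hη]; field_simp
        _ ≤ a / 2 * mExp ν μ k n := by gcongr
        _ ≤ _ := le_mul_of_one_le_left (by positivity) hf1
    have k3 : (k.factorial : ℝ) * Cful μ k n w ≤ k.factorial * ((1 + a) * mExp ν μ k n) := by
      refine hfin.trans ((add_le_add k1 k2).trans (le_of_eq ?_))
      ring
    have k4 := le_of_mul_le_mul_left k3 (by linarith)
    linarith
  have hfinal : π {w | (1 + a) * mExp ν μ k n < Cful μ k n w ∧ Ln (ε * cA ν μ k a n) w = i} ≤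
      ENNReal.ofReal ((1 + Real.exp 1 * C0 ^ N) * (n : ℝ) ^ (-D)) := by
    calc _ ≤ π {w | ¬ ∀ j, 1 ≤ w j} + (π bad + π E2) :=
          (measure_mono hsub).trans ((measure_union_le _ _).trans (by gcongr; exact measure_union_le _ _))
      _ ≤ 0 + (ENNReal.ofReal ((n : ℝ) ^ (-D)) + ENNReal.ofReal (Real.exp 1 * C0 ^ N * (n : ℝ) ^ (-D))) := by
          rw [p1]; gcongr
      _ = _ := by
          rw [zero_add, ← ENNReal.ofReal_add (by positivity) (by positivity)]
          congr 1; ring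
  refine (ENNReal.toReal_le_of_le_ofReal (by positivity) hfinal).trans ?_
  have hG : G0 * (n : ℝ) ^ (-D) ≤ ((n : ℝ) * (ν (Set.Ioi (cA ν μ k a n))).toReal) ^ (k - 2) := by
    have q1 : (ν (Ioi (C1 * (n : ℝ) ^ γ))).toReal ≤ (ν (Ioi (cA ν μ k a n))).toReal :=
      ENNReal.toReal_mono (measure_ne_top _ _) (measure_mono (Ioi_subset_Ioi hcA))
    have q2 := hlo _ hc
    have q3 : (1 / 2 * C1 ^ (-α)) * (n : ℝ) ^ (1 - α * γ) = n * (1 / 2 * (C1 * (n : ℝ) ^ γ) ^ (-α)) := by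
      rw [Real.mul_rpow hC1.le (by positivity), ← Real.rpow_mul hn'.le, show 1 - α * γ = 1 + γ * -α by ring,
        Real.rpow_add hn', Real.rpow_one]
      ring
    calc G0 * (n : ℝ) ^ (-D) = ((1 / 2 * C1 ^ (-α)) * (n : ℝ) ^ (1 - α * γ)) ^ (k - 2) := by
          rw [pow_form hn', hG0]; congr 2; rw [hD]; ring
      _ ≤ _ := by
        rw [q3]
        gcongr
        exact q2.trans q1
  calc (1 + Real.exp 1 * C0 ^ N) * (n : ℝ) ^ (-D) =
        (1 + Real.exp 1 * C0 ^ N) / G0 * (G0 * (n : ℝ) ^ (-D)) := by field_simp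
    _ ≤ _ := by gcongr
end
end
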